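/- arXiv:2206.07667 — 2 statements merged into one kernel-verified Lean document; each statement's English description precedes it below -/
import Mathlib

section
/- There exist constants C₀, C > 0 independent of ε and N such that: if ε ≤ C₀ N^{−1} and λ = 2ε ln N/√m < 1/4, then for all i = N/4, …, N/2 − 1 (so that x_{i−1}, x_i, x_{i+1} ∈ [x_{N/4−1}, 1/2]), | [ (y(x_{i−1}) − y(x_i))/sinh(βh_{i−1}) − (y(x_i) − y(x_{i+1}))/sinh(βh_i) ] / ( A(h_{i−1}) + A(h_i) ) | ≤ C N^{−2}, where y is the exact solution of the boundary value problem. -/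
/-- The modified Shishkin (Vulanović) mesh-generating function. -/
noncomputable def shishkinPsi (lam t : ℝ) : ℝ :=
  if t ≤ 1 / 2 then
    (if t ≤ 1 / 4 then 4 * lam * t
     else 32 * (1 - 4 * lam) * (t - 1 / 4) ^ 3 + 4 * lam * t)
  else
    1 - (if 1 - t ≤ 1 / 4 then 4 * lam * (1 - t)
         else 32 * (1 - 4 * lam) * ((1 - t) - 1 / 4) ^ 3 + 4 * lam * (1 - t))

/-- `A(h) = (cosh(βh) − 1)/sinh(βh)`. -/
noncomputable def Acoef (β h : ℝ) : ℝ := (Real.cosh (β * h) - 1) / Real.sinh (β * h)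

open Set

lemma nonpos_of_second_deriv_pos {g g' g'' : ℝ → ℝ} (hc : ContinuousOn g (Icc 0 1))
    (h0 : g 0 ≤ 0) (h1 : g 1 ≤ 0)
    (hg : ∀ x ∈ Ioo (0:ℝ) 1, HasDerivAt g (g' x) x)
    (hg' : ∀ x ∈ Ioo (0:ℝ) 1, HasDerivAt g' (g'' x) x)
    (hpos : ∀ x ∈ Ioo (0:ℝ) 1, 0 < g x → 0 < g'' x) :
    ∀ x ∈ Icc (0:ℝ) 1, g x ≤ 0 := by
  obtain ⟨c, hcI, hmax⟩ := isCompact_Icc.exists_isMaxOn (nonempty_Icc.2 zero_le_one) hc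
  intro x hx
  refine (hmax hx).trans ?_
  by_contra! hgc
  have hc' : c ∈ Ioo (0:ℝ) 1 := by
    refine ⟨lt_of_le_of_ne hcI.1 ?_, lt_of_le_of_ne hcI.2 ?_⟩
    · rintro rfl; linarith
    · rintro rfl; linarith
  have hlmax : IsLocalMax g c := hmax.isLocalMax (Icc_mem_nhds hc'.1 hc'.2)
  have hev : deriv g =ᶠ[nhds c] g' := by
    filter_upwards [Ioo_mem_nhds hc'.1 hc'.2] with t ht using (hg t ht).deriv
  have hdd : deriv (deriv g) c = g'' c := hev.deriv_eq.trans (hg' c hc').deriv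
  have hlmin : IsLocalMin g c :=
    isLocalMin_of_deriv_deriv_pos (hdd ▸ hpos c hc' hgc) hlmax.deriv_eq_zero
      (hg c hc').continuousAt
  have hconst : g =ᶠ[nhds c] fun _ => g c := by
    filter_upwards [hlmax, hlmin] with t h1 h2 using le_antisymm h1 h2
  have : deriv (deriv g) c = 0 := by
    rw [hconst.deriv.deriv_eq]; simp
  linarith [hpos c hc' hgc]

lemma sinh_sub_sinh_le {a b : ℝ} (ha : 0 ≤ a) (hab : a ≤ b) :
    Real.sinh b - Real.sinh a ≤ (b - a) * Real.cosh b := by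
  rcases hab.eq_or_lt with rfl | hlt
  · simp
  obtain ⟨c, hc, hd⟩ := exists_hasDerivAt_eq_slope Real.sinh Real.cosh hlt
    Real.continuous_sinh.continuousOn (fun x _ => Real.hasDerivAt_sinh x)
  have hcb : Real.cosh c ≤ Real.cosh b := by
    rw [Real.cosh_le_cosh, abs_of_pos (ha.trans_lt hc.1), abs_of_pos (ha.trans_lt hlt)]
    exact hc.2.le
  rw [eq_div_iff (sub_pos.2 hlt).ne'] at hd
  nlinarith [sub_pos.2 hlt]

lemma div_sinh_antitone_bounds {a b : ℝ} (ha : 0 < a) (hab : a ≤ b) :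
    |a / Real.sinh a - b / Real.sinh b| ≤
      min (b - a) 1 * ((Real.cosh b - 1) / Real.sinh b) := by
  have hb := ha.trans_le hab
  have hsa : 0 < Real.sinh a := Real.sinh_pos_iff.2 ha
  have hsb : 0 < Real.sinh b := Real.sinh_pos_iff.2 hb
  have ha1 : a ≤ Real.sinh a := Real.self_le_sinh_iff.2 ha.le
  have hmono : b / Real.sinh b ≤ a / Real.sinh a := by
    rw [div_le_div_iff₀ hsb hsa]
    have hconv : ConvexOn ℝ (Ici 0) Real.sinh := by
      apply convexOn_of_deriv2_nonneg (convex_Ici 0) Real.continuous_sinh.continuousOn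
        Real.differentiable_sinh.differentiableOn
      · simpa using Real.differentiable_cosh.differentiableOn
      · intro x hx
        simp at hx
        simpa using hx.le
    have h1 := hconv.2 (mem_Ici.2 le_rfl) (mem_Ici.2 hb.le)
      (sub_nonneg.2 ((div_le_one hb).2 hab)) (by positivity) (sub_add_cancel 1 (a / b))
    simp only [smul_eq_mul, mul_zero, Real.sinh_zero, zero_add, div_mul_cancel₀ _ hb.ne'] at h1
    rw [div_mul_eq_mul_div, le_div_iff₀ hb] at h1
    linarith
  rw [abs_of_nonneg (sub_nonneg.2 hmono)]
  have hA : 0 ≤ (Real.cosh b - 1) / Real.sinh b :=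
    div_nonneg (sub_nonneg.2 (Real.one_le_cosh b)) hsb.le
  rw [min_mul_of_nonneg _ _ hA, one_mul, le_min_iff]
  constructor
  · have h1 := sinh_sub_sinh_le ha.le hab
    have h2 : a / Real.sinh a ≤ 1 := (div_le_one hsa).2 ha1
    have h3 : a / Real.sinh a * (Real.sinh b - Real.sinh a) ≤ (b - a) * Real.cosh b := by
      refine (mul_le_of_le_one_left ?_ h2).trans h1
      exact sub_nonneg.2 (Real.sinh_le_sinh.2 hab)
    have h4 : a / Real.sinh a * Real.sinh a = a := div_mul_cancel₀ _ hsa.ne'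
    rw [mul_div_assoc', sub_le_iff_le_add, ← add_div, le_div_iff₀ hsb]
    nlinarith
  · have h2 : a / Real.sinh a ≤ 1 := (div_le_one hsa).2 ha1
    have h3 : 1 - b / Real.sinh b ≤ (Real.cosh b - 1) / Real.sinh b := by
      rw [sub_le_iff_le_add, ← add_div, le_div_iff₀ hsb]
      have := Real.add_one_le_exp (-b)
      have h5 := Real.cosh_sub_sinh b
      linarith
    linarith

lemma sq_le_two_mul_cosh_sub_one {b : ℝ} (hb : 0 ≤ b) : b ^ 2 ≤ 2 * (Real.cosh b - 1) := by
  have h1 : b / 2 ≤ Real.sinh (b / 2) := Real.self_le_sinh_iff.2 (by linarith)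
  have h2 : Real.cosh b = Real.cosh (2 * (b / 2)) := by ring_nf
  rw [h2, Real.cosh_two_mul, Real.cosh_sq]
  nlinarith

lemma abs_sub_le_of_second_deriv_bound {u u' : ℝ → ℝ} {a b Q : ℝ}
    (hu : ∀ x ∈ Ioo a b, HasDerivAt u (u' x) x) (hQ : ∀ x ∈ Ioo a b, |u' x| ≤ Q)
    {s t : ℝ} (hs : s ∈ Ioo a b) (ht : t ∈ Ioo a b) : |u t - u s| ≤ Q * |t - s| :=
  (convex_Ioo a b).norm_image_sub_le_of_norm_hasDerivWithin_le
    (fun x hx => (hu x hx).hasDerivWithinAt) hQ hs ht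

lemma deriv_bound_of_bounds {u u' u'' : ℝ → ℝ} {a b M₀ M₂ δ : ℝ} (hδ : 0 < δ)
    (hδab : 2 * δ ≤ b - a)
    (hu : ∀ x ∈ Ioo a b, HasDerivAt u (u' x) x)
    (hu' : ∀ x ∈ Ioo a b, HasDerivAt u' (u'' x) x)
    (h0 : ∀ x ∈ Ioo a b, |u x| ≤ M₀) (h2 : ∀ x ∈ Ioo a b, |u'' x| ≤ M₂) :
    ∀ x ∈ Ioo a b, |u' x| ≤ 4 * M₀ / δ + M₂ * δ := by
  intro x hx
  have hM2 : 0 ≤ M₂ := (abs_nonneg _).trans (h2 x hx)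
  have key : ∀ p q, p ∈ Ioo a b → q ∈ Ioo a b → q - p = δ / 2 → (x = p ∨ x = q) →
      |u' x| ≤ 4 * M₀ / δ + M₂ * δ := by
    intro p q hp hq hpq hxpq
    have hsub : Icc p q ⊆ Ioo a b := Icc_subset_Ioo hp.1 hq.2
    obtain ⟨c, hc, hd⟩ := exists_hasDerivAt_eq_slope u u' (by linarith : p < q)
      (fun t ht => (hu t (hsub ht)).continuousAt.continuousWithinAt)
      (fun t ht => hu t (hsub (Ioo_subset_Icc_self ht)))
    have hcI := hsub (Ioo_subset_Icc_self hc)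
    have h3 := abs_sub_le_of_second_deriv_bound hu' h2 hcI hx
    have h4 : |x - c| ≤ δ := by
      rw [abs_le]; rcases hxpq with rfl | rfl <;> constructor <;> linarith [hc.1, hc.2]
    have h5 : |u' c| ≤ 4 * M₀ / δ := by
      rw [hd, hpq, abs_div, abs_of_pos (half_pos hδ), div_le_div_iff₀ (half_pos hδ) hδ]
      have := abs_sub (u q) (u p)
      have := h0 p hp
      have := h0 q hq
      nlinarith
    have h6 : |u' x| ≤ |u' c| + |u' x - u' c| := by
      have := abs_add_le (u' c) (u' x - u' c); simpa using this
    have := mul_le_mul_of_nonneg_left h4 hM2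
    linarith
  by_cases hxb : x + δ / 2 < b
  · exact key x (x + δ / 2) hx ⟨by linarith [hx.1], hxb⟩ (by ring) (Or.inl rfl)
  · exact key (x - δ / 2) x ⟨by linarith, by linarith [hx.2]⟩ hx (by ring) (Or.inr rfl)

lemma sinh_difference_bound_of_deriv_bounds {u u' u'' : ℝ → ℝ} {x₀ x₁ x₂ β P Q : ℝ} (hβ : 0 < β)
    (h01 : x₀ < x₁) (h12 : x₁ < x₂) (hh : x₁ - x₀ ≤ x₂ - x₁)
    (hc : ContinuousOn u (Icc x₀ x₂))
    (hu : ∀ x ∈ Ioo x₀ x₂, HasDerivAt u (u' x) x)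
    (hu' : ∀ x ∈ Ioo x₀ x₂, HasDerivAt u' (u'' x) x)
    (hP : ∀ x ∈ Ioo x₀ x₂, |u' x| ≤ P) (hQ : ∀ x ∈ Ioo x₀ x₂, |u'' x| ≤ Q) :
    |((u x₀ - u x₁) / Real.sinh (β * (x₁ - x₀)) - (u x₁ - u x₂) / Real.sinh (β * (x₂ - x₁))) /
      (Acoef β (x₁ - x₀) + Acoef β (x₂ - x₁))| ≤
      P * min ((x₂ - x₁) - (x₁ - x₀)) β⁻¹ + 4 * Q / β ^ 2 := by
  obtain ⟨c, hcI, hcd⟩ := exists_hasDerivAt_eq_slope u u' h01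
    (hc.mono (Icc_subset_Icc_right h12.le)) (fun t ht => hu t ⟨ht.1, ht.2.trans h12⟩)
  obtain ⟨d, hdI, hdd⟩ := exists_hasDerivAt_eq_slope u u' h12
    (hc.mono (Icc_subset_Icc_left h01.le)) (fun t ht => hu t ⟨h01.trans ht.1, ht.2⟩)
  have hcJ : c ∈ Ioo x₀ x₂ := ⟨hcI.1, hcI.2.trans h12⟩
  have hdJ : d ∈ Ioo x₀ x₂ := ⟨h01.trans hdI.1, hdI.2⟩
  have hP0 : 0 ≤ P := (abs_nonneg _).trans (hP c hcJ)
  have hQ0 : 0 ≤ Q := (abs_nonneg _).trans (hQ c hcJ)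
  have hdiff := abs_sub_le_of_second_deriv_bound hu' hQ hdJ hcJ
  have hcd' : |c - d| ≤ 2 * (x₂ - x₁) := by
    rw [abs_le]; constructor <;> linarith [hcI.1, hcI.2, hdI.1, hdI.2]
  have e1 : u x₀ - u x₁ = -(u' c * (x₁ - x₀)) := by
    rw [hcd, div_mul_cancel₀ _ (sub_pos.2 h01).ne']; ring
  have e2 : u x₁ - u x₂ = -(u' d * (x₂ - x₁)) := by
    rw [hdd, div_mul_cancel₀ _ (sub_pos.2 h12).ne']; ring
  rw [e1, e2]
  set p := x₁ - x₀ with hp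
  set q := x₂ - x₁ with hq
  have hp0 : 0 < p := sub_pos.2 h01
  have hq0 : 0 < q := sub_pos.2 h12
  have ha : 0 < β * p := mul_pos hβ hp0
  have hb : 0 < β * q := mul_pos hβ hq0
  have hab : β * p ≤ β * q := mul_le_mul_of_nonneg_left hh hβ.le
  have hsa : 0 < Real.sinh (β * p) := Real.sinh_pos_iff.2 ha
  have hsb : 0 < Real.sinh (β * q) := Real.sinh_pos_iff.2 hb
  have hA1 : 0 ≤ Acoef β p := div_nonneg (sub_nonneg.2 (Real.one_le_cosh _)) hsa.le
  have hA2 : 0 < Acoef β q := div_pos (sub_pos.2 (Real.one_lt_cosh.2 hb.ne')) hsb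
  have hg := div_sinh_antitone_bounds ha hab
  have hgg : β * q * (β * q / Real.sinh (β * q)) ≤ 2 * Acoef β q := by
    unfold Acoef
    rw [mul_div_assoc', mul_div_assoc']
    refine div_le_div_of_nonneg_right ?_ hsb.le
    linarith [sq_le_two_mul_cosh_sub_one hb.le]
  rw [abs_div, abs_of_pos (add_pos_of_nonneg_of_pos hA1 hA2),
    div_le_iff₀ (add_pos_of_nonneg_of_pos hA1 hA2)]
  have e3 : -(u' c * p) / Real.sinh (β * p) - -(u' d * q) / Real.sinh (β * q)
      = -(β⁻¹ * (u' c * (β * p / Real.sinh (β * p) - β * q / Real.sinh (β * q))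
        + (u' c - u' d) * (β * q / Real.sinh (β * q)))) := by
    field_simp; ring
  have hRHS : (P * min (q - p) β⁻¹ + 4 * Q / β ^ 2) * Acoef β q ≤
      (P * min (q - p) β⁻¹ + 4 * Q / β ^ 2) * (Acoef β p + Acoef β q) := by
    have : 0 ≤ min (q - p) β⁻¹ := le_min (by linarith) (by positivity)
    gcongr
    linarith
  refine le_trans ?_ hRHS
  have hmin : min (β * q - β * p) 1 = β * min (q - p) β⁻¹ := by
    rw [mul_min_of_nonneg _ _ hβ.le, mul_inv_cancel₀ hβ.ne', mul_sub β q p]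
  rw [hmin] at hg
  have t1 : |u' c * (β * p / Real.sinh (β * p) - β * q / Real.sinh (β * q))| ≤
      P * (β * min (q - p) β⁻¹ * Acoef β q) := by
    rw [abs_mul]
    exact mul_le_mul (hP c hcJ) hg (abs_nonneg _) hP0
  have t2 : |(u' c - u' d) * (β * q / Real.sinh (β * q))| ≤ 4 * Q * β⁻¹ * Acoef β q := by
    have hpos : 0 ≤ β * q / Real.sinh (β * q) := by positivity
    rw [abs_mul, abs_of_nonneg hpos]
    calc |u' c - u' d| * (β * q / Real.sinh (β * q))
        ≤ (Q * (2 * q)) * (β * q / Real.sinh (β * q)) := by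
          gcongr
          exact hdiff.trans (mul_le_mul_of_nonneg_left hcd' hQ0)
      _ = 2 * Q * β⁻¹ * (β * q * (β * q / Real.sinh (β * q))) := by field_simp
      _ ≤ 2 * Q * β⁻¹ * (2 * Acoef β q) := by gcongr
      _ = _ := by ring
  rw [e3, abs_neg, abs_mul, abs_of_pos (inv_pos.2 hβ)]
  calc _ ≤ β⁻¹ * (P * (β * min (q - p) β⁻¹ * Acoef β q) + 4 * Q * β⁻¹ * Acoef β q) := by
        gcongr
        exact (abs_add_le _ _).trans (add_le_add t1 t2)
    _ = _ := by field_simp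

lemma mul_abs_sub_le_abs_sub_of_le_deriv {g : ℝ → ℝ} {m : ℝ} (hm : 0 < m) (hg : ∀ u, m ≤ deriv g u)
    (u v : ℝ) : m * |u - v| ≤ |g u - g v| := by
  have hd : Differentiable ℝ g := fun u =>
    differentiableAt_of_deriv_ne_zero (hm.trans_le (hg u)).ne'
  wlog huv : v ≤ u generalizing u v
  · rw [abs_sub_comm u, abs_sub_comm (g u)]
    exact this v u (le_of_not_ge huv)
  have := mul_sub_le_image_sub_of_le_deriv hd hg huv
  rw [abs_of_nonneg (sub_nonneg.2 huv)]
  exact this.trans (le_abs_self _)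

lemma exists_zero_of_le_deriv {g : ℝ → ℝ} {m : ℝ} (hm : 0 < m) (hg : ∀ u, m ≤ deriv g u) :
    ∃ u, g u = 0 := by
  have hd : Differentiable ℝ g := fun u =>
    differentiableAt_of_deriv_ne_zero (hm.trans_le (hg u)).ne'
  have hR : 0 ≤ |g 0| / m := by positivity
  have h1 := mul_sub_le_image_sub_of_le_deriv hd hg hR
  have h2 := mul_sub_le_image_sub_of_le_deriv hd hg (neg_nonpos.2 hR)
  have h3 : m * (|g 0| / m) = |g 0| := by field_simp
  have h4 := neg_abs_le (g 0)
  have h5 := le_abs_self (g 0)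
  have hle : -(|g 0| / m) ≤ |g 0| / m := by linarith
  obtain ⟨u, -, hu⟩ := intermediate_value_Icc hle hd.continuous.continuousOn
    (show (0:ℝ) ∈ Icc _ _ from ⟨by linarith, by linarith⟩)
  exact ⟨u, hu⟩

/-- Implicit differentiation of the zero set of a function that is uniformly monotone in its
second variable. -/
lemma hasDerivWithinAt_implicit {F : ℝ × ℝ → ℝ} {D : ℝ × ℝ →L[ℝ] ℝ} {z : ℝ → ℝ} {I : Set ℝ}
    {m x : ℝ} (hm : 0 < m) (hx : x ∈ I)
    (hmono : ∀ a ∈ I, ∀ u v, m * |u - v| ≤ |F (a, u) - F (a, v)|)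
    (hz : ∀ a ∈ I, F (a, z a) = 0)
    (hF : HasFDerivWithinAt F D (I ×ˢ univ) (x, z x)) (hD : D (0, 1) ≠ 0) :
    HasDerivWithinAt z (-D (1, 0) / D (0, 1)) I x := by
  have hO : (fun a => z a - z x) =O[nhdsWithin x I] fun a => a - x := by
    have h1 : Filter.Tendsto (fun a => (a, z x)) (nhdsWithin x I)
        (nhdsWithin (x, z x) (I ×ˢ univ)) := by
      apply tendsto_nhdsWithin_of_tendsto_nhds_of_eventually_within
      · exact (Continuous.tendsto (by fun_prop : Continuous fun a : ℝ => (a, z x)) x).mono_left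
          nhdsWithin_le_nhds
      · filter_upwards [self_mem_nhdsWithin] with a ha using ⟨ha, mem_univ _⟩
    have h2 := hF.isBigO_sub.comp_tendsto h1
    have h3 : (fun a => z a - z x) =O[nhdsWithin x I] fun a => F (a, z x) - F (x, z x) := by
      apply Asymptotics.IsBigO.of_bound m⁻¹
      filter_upwards [self_mem_nhdsWithin] with a ha
      have := hmono a ha (z a) (z x)
      rw [hz a ha, zero_sub, abs_neg] at this
      rw [hz x hx, sub_zero, inv_mul_eq_div, le_div_iff₀ hm, mul_comm]
      exact this
    refine (h3.trans h2).trans ?_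
    apply Asymptotics.IsBigO.of_bound 1
    filter_upwards with a
    simp
  have hzc : Filter.Tendsto z (nhdsWithin x I) (nhds (z x)) := by
    have h0 : Filter.Tendsto (fun a => a - x) (nhdsWithin x I) (nhds 0) := by
      have : Filter.Tendsto (fun a => a - x) (nhds x) (nhds (x - x)) :=
        (continuous_id.sub continuous_const).tendsto x
      rw [sub_self] at this
      exact this.mono_left nhdsWithin_le_nhds
    have := (hO.trans_tendsto h0).add_const (z x)
    simpa using this
  have h1 : Filter.Tendsto (fun a => (a, z a)) (nhdsWithin x I)
      (nhdsWithin (x, z x) (I ×ˢ univ)) := by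
    apply tendsto_nhdsWithin_of_tendsto_nhds_of_eventually_within
    · exact (Filter.tendsto_id.mono_left nhdsWithin_le_nhds).prodMk_nhds hzc
    · filter_upwards [self_mem_nhdsWithin] with a ha using ⟨ha, mem_univ _⟩
  have h2 := hF.isLittleO.comp_tendsto h1
  have h3 : (fun a => (a, z a) - (x, z x)) =O[nhdsWithin x I] fun a => a - x := by
    simp only [Prod.mk_sub_mk]
    exact (Asymptotics.isBigO_refl _ _).prod_left hO
  have h4 := (h2.trans_isBigO h3).const_mul_left (-(D (0, 1))⁻¹)
  rw [hasDerivWithinAt_iff_isLittleO]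
  refine h4.congr' ?_ Filter.EventuallyEq.rfl
  filter_upwards [self_mem_nhdsWithin] with a ha
  have e : D ((a, z a) - (x, z x)) = (a - x) * D (1, 0) + (z a - z x) * D (0, 1) := by
    have : ((a, z a) - (x, z x) : ℝ × ℝ) = (a - x) • (1, 0) + (z a - z x) • (0, 1) := by
      ext <;> simp
    rw [this, map_add, map_smul, map_smul, smul_eq_mul, smul_eq_mul]
  simp only [Function.comp, hz a ha, hz x hx, e, smul_eq_mul]
  field_simp
  ring

/-- The reduced solution `f(x, z(x)) = 0` is twice differentiable with bounded derivatives. -/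
lemma exists_reduced_solution {f : ℝ → ℝ → ℝ} {m : ℝ} (hm : 0 < m)
    (hf : ContDiffOn ℝ 2 (Function.uncurry f) (Icc 0 1 ×ˢ univ))
    (hfy : ∀ a ∈ Icc (0:ℝ) 1, ∀ u : ℝ, m ≤ deriv (f a) u) :
    ∃ z z' z'' : ℝ → ℝ, ∃ Z : ℝ, 0 ≤ Z ∧ ContinuousOn z (Icc 0 1) ∧
      (∀ x ∈ Icc (0:ℝ) 1, f x (z x) = 0) ∧
      (∀ x ∈ Ioo (0:ℝ) 1, HasDerivAt z (z' x) x) ∧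
      (∀ x ∈ Ioo (0:ℝ) 1, HasDerivAt z' (z'' x) x) ∧
      ∀ x ∈ Icc (0:ℝ) 1, |z x| ≤ Z ∧ |z' x| ≤ Z ∧ |z'' x| ≤ Z := by
  set S : Set (ℝ × ℝ) := Icc 0 1 ×ˢ univ with hS
  set F := Function.uncurry f with hFdef
  have huS : UniqueDiffOn ℝ S := (uniqueDiffOn_Icc zero_lt_one).prod uniqueDiffOn_univ
  have hex : ∀ x : ℝ, ∃ u, x ∈ Icc (0:ℝ) 1 → f x u = 0 := by
    intro x
    by_cases hx : x ∈ Icc (0:ℝ) 1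
    · obtain ⟨u, hu⟩ := exists_zero_of_le_deriv hm (hfy x hx)
      exact ⟨u, fun _ => hu⟩
    · exact ⟨0, fun h => absurd h hx⟩
  choose z hz using hex
  set DF := fderivWithin ℝ F S with hDF
  have hFd : ∀ p ∈ S, HasFDerivWithinAt F (DF p) S p := fun p hp =>
    ((hf.differentiableOn (by norm_num)) p hp).hasFDerivWithinAt
  have hDF1 : ContDiffOn ℝ 1 DF S := hf.fderivWithin huS (by norm_num)
  have hDFy : ∀ p ∈ S, DF p (0, 1) = deriv (f p.1) p.2 := by
    rintro ⟨a, u⟩ hp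
    have hcurve : HasDerivAt (fun v : ℝ => (a, v)) ((0:ℝ), (1:ℝ)) u :=
      (hasDerivAt_const u a).prodMk (hasDerivAt_id u)
    have := (hFd _ hp).comp_hasDerivWithinAt (s := univ) u hcurve.hasDerivWithinAt
      (fun v _ => ⟨hp.1, mem_univ _⟩)
    exact (hasDerivWithinAt_univ.1 this).deriv.symm
  have hne : ∀ p ∈ S, DF p (0, 1) ≠ 0 := fun p hp => by
    rw [hDFy p hp]
    exact (hm.trans_le (hfy p.1 hp.1 p.2)).ne'
  set G : ℝ × ℝ → ℝ := fun p => -DF p (1, 0) / DF p (0, 1) with hG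
  have hG1 : ContDiffOn ℝ 1 G S :=
    ((hDF1.clm_apply contDiffOn_const).neg).div (hDF1.clm_apply contDiffOn_const) hne
  have hzd : ∀ x ∈ Icc (0:ℝ) 1, HasDerivWithinAt z (G (x, z x)) (Icc 0 1) x := fun x hx =>
    hasDerivWithinAt_implicit hm hx
      (fun a ha u v => mul_abs_sub_le_abs_sub_of_le_deriv hm (hfy a ha) u v)
      (fun a ha => hz a ha) (hFd _ ⟨hx, mem_univ _⟩) (hne _ ⟨hx, mem_univ _⟩)
  have hzc : ContinuousOn z (Icc 0 1) := fun x hx => (hzd x hx).continuousWithinAt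
  have hmaps : MapsTo (fun x => (x, z x)) (Icc (0:ℝ) 1) S := fun x hx => ⟨hx, mem_univ _⟩
  have hpc : ContinuousOn (fun x => (x, z x)) (Icc (0:ℝ) 1) := continuousOn_id.prodMk hzc
  have hz1c : ContinuousOn (fun x => G (x, z x)) (Icc 0 1) := hG1.continuousOn.comp hpc hmaps
  set z'' : ℝ → ℝ := fun x => fderivWithin ℝ G S (x, z x) (1, G (x, z x)) with hz''
  have hz2c : ContinuousOn z'' (Icc 0 1) :=
    ((hG1.continuousOn_fderivWithin huS le_rfl).comp hpc hmaps).clm_apply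
      (continuousOn_const.prodMk hz1c)
  have hz2 : ∀ x ∈ Icc (0:ℝ) 1,
      HasDerivWithinAt (fun x => G (x, z x)) (z'' x) (Icc 0 1) x := fun x hx => by
    have hGd : HasFDerivWithinAt G (fderivWithin ℝ G S (x, z x)) S (x, z x) :=
      ((hG1.differentiableOn one_ne_zero) _ (hmaps hx)).hasFDerivWithinAt
    exact hGd.comp_hasDerivWithinAt (f := fun x => (x, z x)) x
      ((hasDerivWithinAt_id x _).prodMk (hzd x hx)) hmaps
  obtain ⟨Z₀, h₀⟩ := isCompact_Icc.exists_bound_of_continuousOn hzc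
  obtain ⟨Z₁, h₁⟩ := isCompact_Icc.exists_bound_of_continuousOn hz1c
  obtain ⟨Z₂, h₂⟩ := isCompact_Icc.exists_bound_of_continuousOn hz2c
  have hnn : 0 ≤ max Z₀ (max Z₁ Z₂) :=
    ((norm_nonneg _).trans (h₀ 0 ⟨le_rfl, zero_le_one⟩)).trans (le_max_left _ _)
  refine ⟨z, fun x => G (x, z x), z'', max Z₀ (max Z₁ Z₂), hnn, hzc, hz, ?_, ?_, ?_⟩
  · exact fun x hx => (hzd x (Ioo_subset_Icc_self hx)).hasDerivAt (Icc_mem_nhds hx.1 hx.2)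
  · exact fun x hx => (hz2 x (Ioo_subset_Icc_self hx)).hasDerivAt (Icc_mem_nhds hx.1 hx.2)
  · exact fun x hx => ⟨(h₀ x hx).trans (le_max_left _ _),
      (h₁ x hx).trans ((le_max_left _ _).trans (le_max_right _ _)),
      (h₂ x hx).trans ((le_max_right _ _).trans (le_max_right _ _))⟩

lemma hasDerivAt_derivWithin_of_contDiffOn_two {y : ℝ → ℝ} (hy : ContDiffOn ℝ 2 y (Icc 0 1))
    {x : ℝ} (hx : x ∈ Ioo (0:ℝ) 1) :
    HasDerivAt y (derivWithin y (Icc 0 1) x) x ∧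
      HasDerivAt (derivWithin y (Icc 0 1)) (iteratedDerivWithin 2 y (Icc 0 1) x) x := by
  have hI := Ioo_subset_Icc_self hx
  have hn := Icc_mem_nhds hx.1 hx.2
  have hu := uniqueDiffOn_Icc (zero_lt_one (α := ℝ))
  have h1 : ContDiffOn ℝ 1 (derivWithin y (Icc 0 1)) (Icc 0 1) :=
    hy.derivWithin hu (by norm_num)
  refine ⟨((hy.differentiableOn (by norm_num)) x hI).hasDerivWithinAt.hasDerivAt hn, ?_⟩
  have := ((h1.differentiableOn (by norm_num)) x hI).hasDerivWithinAt.hasDerivAt hn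
  rw [iteratedDerivWithin_succ, iteratedDerivWithin_one]
  exact this

/-- Barrier estimate for `ε² s'' ≥ m s - ε² Z`: boundary layers plus an `O(ε²)` term. -/
lemma le_boundary_layer_barrier {s s' s'' : ℝ → ℝ} {ε m Z : ℝ} (hε : 0 < ε) (hm : 0 < m)
    (hZ : 0 ≤ Z) (hc : ContinuousOn s (Icc 0 1)) (h0 : s 0 ≤ Z) (h1 : s 1 ≤ Z)
    (hs : ∀ x ∈ Ioo (0:ℝ) 1, HasDerivAt s (s' x) x)
    (hs' : ∀ x ∈ Ioo (0:ℝ) 1, HasDerivAt s' (s'' x) x)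
    (hode : ∀ x ∈ Ioo (0:ℝ) 1, 0 < s x → m * s x - ε ^ 2 * Z ≤ ε ^ 2 * s'' x) :
    ∀ x ∈ Icc (0:ℝ) 1, s x ≤
      Z * (Real.exp (-(√m / ε) * x) + Real.exp (-(√m / ε) * (1 - x))) + ε ^ 2 * Z / m := by
  set μ := √m / ε with hμ
  have hμ2 : ε ^ 2 * μ ^ 2 = m := by
    rw [hμ, div_pow, Real.sq_sqrt hm.le]; field_simp
  have hR : 0 ≤ ε ^ 2 * Z / m := by positivity
  have hd1 : ∀ x : ℝ, HasDerivAt (fun x => Real.exp (-μ * x)) (-μ * Real.exp (-μ * x)) x := by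
    intro x
    have := ((hasDerivAt_id x).const_mul (-μ)).exp
    simpa [mul_comm] using this
  have hd2 : ∀ x : ℝ, HasDerivAt (fun x => Real.exp (-μ * (1 - x)))
      (μ * Real.exp (-μ * (1 - x))) x := by
    intro x
    have := (((hasDerivAt_id x).const_sub 1).const_mul (-μ)).exp
    simpa [mul_comm] using this
  have hB : ∀ x : ℝ, HasDerivAt
      (fun x => Z * (Real.exp (-μ * x) + Real.exp (-μ * (1 - x))) + ε ^ 2 * Z / m)
      (Z * (-μ * Real.exp (-μ * x) + μ * Real.exp (-μ * (1 - x)))) x := fun x =>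
    (((hd1 x).add (hd2 x)).const_mul Z).add_const _
  have hB' : ∀ x : ℝ, HasDerivAt
      (fun x => Z * (-μ * Real.exp (-μ * x) + μ * Real.exp (-μ * (1 - x))))
      (Z * (-μ * (-μ * Real.exp (-μ * x)) + μ * (μ * Real.exp (-μ * (1 - x))))) x := fun x =>
    ((((hd1 x).const_mul (-μ)).add ((hd2 x).const_mul μ)).const_mul Z)
  intro x hx
  rw [← sub_nonpos]
  refine nonpos_of_second_deriv_pos
    (g := fun x => s x - (Z * (Real.exp (-μ * x) + Real.exp (-μ * (1 - x))) + ε ^ 2 * Z / m))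
    (hc.sub fun x _ => (hB x).continuousAt.continuousWithinAt) ?_ ?_
    (fun x hx => (hs x hx).sub (hB x)) (fun x hx => (hs' x hx).sub (hB' x)) ?_ x hx
  · have : 0 ≤ Z * Real.exp (-μ) := by positivity
    simp; linarith
  · have : 0 ≤ Z * Real.exp (-μ) := by positivity
    simp; linarith
  · intro x hx hpos
    have hE : 0 ≤ Z * (Real.exp (-μ * x) + Real.exp (-μ * (1 - x))) := by positivity
    have h := hode x hx (by linarith)
    have h3 : m * (ε ^ 2 * Z / m) = ε ^ 2 * Z := by field_simp
    have h4 := mul_pos hm hpos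
    refine pos_of_mul_pos_right (a := ε ^ 2) ?_ (by positivity)
    have e : ε ^ 2 * (s'' x -
        Z * (-μ * (-μ * Real.exp (-μ * x)) + μ * (μ * Real.exp (-μ * (1 - x))))) =
        ε ^ 2 * s'' x -
          ε ^ 2 * μ ^ 2 * (Z * (Real.exp (-μ * x) + Real.exp (-μ * (1 - x)))) := by ring
    rw [e, hμ2]
    linarith

lemma abs_le_boundary_layer_barrier {s s' s'' : ℝ → ℝ} {ε m Z : ℝ} (hε : 0 < ε) (hm : 0 < m)
    (hZ : 0 ≤ Z) (hc : ContinuousOn s (Icc 0 1)) (h0 : |s 0| ≤ Z) (h1 : |s 1| ≤ Z)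
    (hs : ∀ x ∈ Ioo (0:ℝ) 1, HasDerivAt s (s' x) x)
    (hs' : ∀ x ∈ Ioo (0:ℝ) 1, HasDerivAt s' (s'' x) x)
    (hpos : ∀ x ∈ Ioo (0:ℝ) 1, 0 < s x → m * s x - ε ^ 2 * Z ≤ ε ^ 2 * s'' x)
    (hneg : ∀ x ∈ Ioo (0:ℝ) 1, s x < 0 → ε ^ 2 * s'' x ≤ m * s x + ε ^ 2 * Z) :
    ∀ x ∈ Icc (0:ℝ) 1, |s x| ≤
      Z * (Real.exp (-(√m / ε) * x) + Real.exp (-(√m / ε) * (1 - x))) + ε ^ 2 * Z / m := by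
  intro x hx
  refine abs_le'.2 ⟨le_boundary_layer_barrier hε hm hZ hc (abs_le'.1 h0).1 (abs_le'.1 h1).1
    hs hs' hpos x hx, ?_⟩
  refine le_boundary_layer_barrier (s := fun x => -s x) hε hm hZ hc.neg (abs_le'.1 h0).2
    (abs_le'.1 h1).2 (fun x hx => (hs x hx).neg) (fun x hx => (hs' x hx).neg) ?_ x hx
  intro x hx h
  linarith [hneg x hx (by linarith)]

lemma shishkinPsi_of_le_half {lam t : ℝ} (ht : t ≤ 1 / 2) :
    shishkinPsi lam t = 32 * (1 - 4 * lam) * max (t - 1 / 4) 0 ^ 3 + 4 * lam * t := by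
  unfold shishkinPsi
  rw [if_pos ht]
  split_ifs with h
  · rw [max_eq_right (by linarith)]; ring
  · rw [max_eq_left (by linarith)]

/-- Geometry of three consecutive points of the modified Shishkin mesh in its coarse left half. -/
lemma shishkinPsi_consecutive {lam t δ : ℝ} (hl0 : 0 < lam) (hl1 : lam < 1 / 4) (hδ : 0 < δ)
    (hδ1 : δ ≤ 1 / 4) (ht : t = 1 / 4 ∨ 1 / 4 + δ ≤ t) (ht2 : t + δ ≤ 1 / 2) :
    4 * lam * (t - δ) ≤ shishkinPsi lam (t - δ) ∧
    shishkinPsi lam (t - δ) < shishkinPsi lam t ∧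
    shishkinPsi lam t < shishkinPsi lam (t + δ) ∧
    shishkinPsi lam t - shishkinPsi lam (t - δ) ≤ shishkinPsi lam (t + δ) - shishkinPsi lam t ∧
    (shishkinPsi lam (t + δ) - shishkinPsi lam t) -
      (shishkinPsi lam t - shishkinPsi lam (t - δ)) ≤ 48 * δ ^ 2 ∧
    shishkinPsi lam (t + δ) ≤ 1 / 2 := by
  rw [shishkinPsi_of_le_half (by linarith : t - δ ≤ 1 / 2),
    shishkinPsi_of_le_half (by linarith : t ≤ 1 / 2), shishkinPsi_of_le_half ht2]
  have hlδ : 0 < lam * δ := by positivity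
  set p := 32 * (1 - 4 * lam) with hp
  have hp0 : 0 < p := by linarith
  have hp1 : p ≤ 32 := by linarith
  have hlast : ∀ r : ℝ, 0 ≤ r → r ≤ 1 / 4 → p * r ^ 3 + 4 * lam * (1 / 4 + r) ≤ 1 / 2 := by
    intro r hr hr1
    have h1 : r ^ 3 ≤ (1 / 4) ^ 3 := pow_le_pow_left₀ hr hr1 3
    have h2 : p * r ^ 3 ≤ p * (1 / 4) ^ 3 := mul_le_mul_of_nonneg_left h1 hp0.le
    have h3 : lam * r ≤ lam * (1 / 4) := mul_le_mul_of_nonneg_left hr1 hl0.le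
    linarith
  rcases ht with rfl | ht
  · rw [max_eq_right (by linarith : 1 / 4 - δ - 1 / 4 ≤ 0), sub_self, max_self,
      max_eq_left (by linarith : 0 ≤ 1 / 4 + δ - 1 / 4), add_sub_cancel_left]
    have h3 : 0 < p * δ ^ 3 := by positivity
    have h4 : p * δ ^ 3 ≤ 48 * δ ^ 2 := by
      have : p * δ ≤ 32 * (1 / 4) := mul_le_mul hp1 hδ1 hδ.le (by norm_num)
      have := mul_le_mul_of_nonneg_right this (sq_nonneg δ)
      nlinarith
    have := hlast δ hδ.le hδ1
    refine ⟨?_, ?_, ?_, ?_, ?_, this⟩ <;> nlinarith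
  · obtain ⟨τ, rfl⟩ : ∃ τ, t = 1 / 4 + τ := ⟨t - 1 / 4, by ring⟩
    have hτ : δ ≤ τ := by linarith
    have hτ1 : τ + δ ≤ 1 / 4 := by linarith
    rw [max_eq_left (by linarith : 0 ≤ 1 / 4 + τ - δ - 1 / 4),
      max_eq_left (by linarith : 0 ≤ 1 / 4 + τ - 1 / 4),
      max_eq_left (by linarith : 0 ≤ 1 / 4 + τ + δ - 1 / 4)]
    rw [show 1 / 4 + τ - δ - 1 / 4 = τ - δ by ring, show 1 / 4 + τ - 1 / 4 = τ by ring,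
      show 1 / 4 + τ + δ - 1 / 4 = τ + δ by ring]
    have h1 : (0:ℝ) ≤ p * (τ - δ) ^ 3 := mul_nonneg hp0.le (pow_nonneg (by linarith) 3)
    have h2 : p * (τ - δ) ^ 3 ≤ p * τ ^ 3 :=
      mul_le_mul_of_nonneg_left (pow_le_pow_left₀ (by linarith) (by linarith) 3) hp0.le
    have h3 : p * τ ^ 3 ≤ p * (τ + δ) ^ 3 :=
      mul_le_mul_of_nonneg_left (pow_le_pow_left₀ (by linarith) (by linarith) 3) hp0.le
    have h4 : 0 ≤ p * τ * δ ^ 2 := by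
      have : 0 ≤ τ := by linarith
      positivity
    have h5 : p * τ * δ ^ 2 ≤ 8 * δ ^ 2 := by
      have : p * τ ≤ 32 * (1 / 4) :=
        mul_le_mul hp1 (by linarith) (by linarith) (by norm_num)
      exact mul_le_mul_of_nonneg_right (by linarith) (sq_nonneg δ)
    refine ⟨by linarith, by linarith, by linarith, by linarith, by linarith, ?_⟩
    have := hlast (τ + δ) (by linarith) hτ1
    linarith

/-- Past the transition point of the Shishkin mesh, up to one mesh step, the boundary layer
function is of size `N⁻²`. -/
lemma exp_neg_le_of_transition_le {m ε N x : ℝ} (hm : 0 < m) (hε : 0 < ε) (hN : 1 ≤ N)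
    (hx : 2 * ε * Real.log N / √m * (1 - 4 / N) ≤ x) :
    Real.exp (-(√m / ε) * x) ≤ Real.exp 8 / N ^ 2 := by
  have hN0 : 0 < N := by linarith
  have hsm : 0 < √m := Real.sqrt_pos.2 hm
  have h1 : 2 * Real.log N * (1 - 4 / N) ≤ √m / ε * x := by
    have := mul_le_mul_of_nonneg_left hx (div_pos hsm hε).le
    refine le_of_eq_of_le ?_ this
    field_simp
  have h2 : Real.log N / N ≤ 1 := by
    rw [div_le_one hN0]
    linarith [Real.log_le_sub_one_of_pos hN0]
  have h3 : 2 * Real.log N * (1 - 4 / N) = 2 * Real.log N - 8 * (Real.log N / N) := by ring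
  have h4 : Real.exp 8 / N ^ 2 = Real.exp (8 - 2 * Real.log N) := by
    rw [Real.exp_sub, two_mul, Real.exp_add, Real.exp_log hN0, sq]
  rw [h4, Real.exp_le_exp]
  linarith

/-- Layer component bounds: a function solving a singularly perturbed problem and small
on an interval of length at least `1/4` has `ε`-scaled derivatives of the same size there. -/
lemma scaled_deriv_bounds {s s' s'' : ℝ → ℝ} {a b ε γ M R : ℝ} (hε : 0 < ε) (hε1 : ε < 1)
    (hab : 1 / 4 ≤ b - a)
    (hs : ∀ x ∈ Ioo a b, HasDerivAt s (s' x) x)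
    (hs' : ∀ x ∈ Ioo a b, HasDerivAt s' (s'' x) x)
    (hγ : 0 ≤ γ) (hM : ∀ x ∈ Ioo a b, |s x| ≤ M)
    (hode : ∀ x ∈ Ioo a b, ε ^ 2 * |s'' x| ≤ γ * |s x| + R) :
    ∀ x ∈ Ioo a b, |s' x| ≤ (32 * M + (γ * M + R)) / ε ∧ |s'' x| ≤ (γ * M + R) / ε ^ 2 := by
  have h2 : ∀ x ∈ Ioo a b, |s'' x| ≤ (γ * M + R) / ε ^ 2 := by
    intro x hx
    rw [le_div_iff₀ (by positivity), mul_comm]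
    refine (hode x hx).trans ?_
    gcongr
    exact hM x hx
  intro x hx
  refine ⟨?_, h2 x hx⟩
  have h0 : 0 ≤ γ * M + R := by
    have : 0 ≤ ε ^ 2 * |s'' x| := by positivity
    have h3 := mul_le_mul_of_nonneg_left (hM x hx) hγ
    linarith [hode x hx]
  refine (deriv_bound_of_bounds (by positivity : 0 < ε / 8) (by linarith) hs hs' hM h2 x hx).trans ?_
  have e : 4 * M / (ε / 8) + (γ * M + R) / ε ^ 2 * (ε / 8) =
      (32 * M + (γ * M + R) / 8) / ε := by field_simp; ring
  rw [e]
  gcongr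
  linarith

/-- Lemma 3: on the part `[x_{N/4-1}, 1/2]` of the modified Shishkin mesh, assuming
`ε ≤ C₀/N` and `λ = 2ε ln N/√m < 1/4`, the `sinh`-weighted combination of differences
of the exact solution is bounded by `C/N²`. -/
theorem lemma3_sinh_difference_bound
    (m γ : ℝ) (k : ℕ) (f : ℝ → ℝ → ℝ)
    (hm : 0 < m) (hk : 2 ≤ k)
    (hf : ContDiffOn ℝ k (Function.uncurry f) (Set.Icc 0 1 ×ˢ Set.univ))
    (hfy : ∀ a ∈ Set.Icc (0:ℝ) 1, ∀ u : ℝ, m ≤ deriv (f a) u)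
    (hγ : ∀ a ∈ Set.Icc (0:ℝ) 1, ∀ u : ℝ, deriv (f a) u ≤ γ) :
    ∃ C₀ > (0:ℝ), ∃ C > (0:ℝ), ∀ (ε : ℝ) (N : ℕ) (y : ℝ → ℝ),
      0 < ε → ε < 1 → 0 < N → 4 ∣ N → ε ≤ C₀ / N →
      ContDiffOn ℝ 2 y (Set.Icc 0 1) → y 0 = 0 → y 1 = 0 →
      (∀ a ∈ Set.Ioo (0:ℝ) 1,
        ε ^ 2 * iteratedDerivWithin 2 y (Set.Icc 0 1) a = f a (y a)) →
      2 * ε * Real.log N / Real.sqrt m < 1 / 4 →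
      let lam : ℝ := 2 * ε * Real.log N / Real.sqrt m
      let β : ℝ := Real.sqrt γ / ε
      let x : ℕ → ℝ := fun i => shishkinPsi lam ((i : ℝ) / (N : ℝ))
      let h : ℕ → ℝ := fun i => x (i + 1) - x i
      ∀ i : ℕ, N / 4 ≤ i → i ≤ N / 2 - 1 →
        |((y (x (i - 1)) - y (x i)) / Real.sinh (β * h (i - 1)) -
          (y (x i) - y (x (i + 1))) / Real.sinh (β * h i)) /
         (Acoef β (h (i - 1)) + Acoef β (h i))| ≤ C / (N : ℝ) ^ 2 := by
  have hγ0 : 0 < γ :=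
    hm.trans_le ((hfy 0 ⟨le_rfl, zero_le_one⟩ 0).trans (hγ 0 ⟨le_rfl, zero_le_one⟩ 0))
  obtain ⟨z, z', z'', Z, hZ, hzc, hz0, hz1, hz2, hzb⟩ :=
    exists_reduced_solution hm (hf.of_le (by exact_mod_cast hk)) hfy
  set M : ℝ := 2 * Z * Real.exp 8 + Z / m with hM
  have hM0 : 0 ≤ M := by positivity
  refine ⟨1, one_pos, 48 * Z + 4 * Z / γ +
    ((32 * M + (γ * M + Z)) / √γ + 4 * (γ * M + Z) / γ) + 1, by positivity, ?_⟩
  intro ε N y hε hε1 hN hdvd hεN hy hy0 hy1 hode hlam lam β x h i hi1 hi2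
  obtain ⟨n, hNn⟩ := hdvd
  have hN4 : (4:ℝ) ≤ (N:ℝ) := by exact_mod_cast (by omega : 4 ≤ N)
  have hNpos : (0:ℝ) < N := by linarith
  have hsm : 0 < √m := Real.sqrt_pos.2 hm
  have hsγ : 0 < √γ := Real.sqrt_pos.2 hγ0
  have hβ : 0 < β := div_pos hsγ hε
  have hlog : 0 < Real.log N := Real.log_pos (by linarith)
  have hlam0 : 0 < lam := by positivity
  have hlam4 : lam < 1 / 4 := hlam
  have hεN2 : ε ^ 2 ≤ 1 / (N:ℝ) ^ 2 := by
    have := pow_le_pow_left₀ hε.le hεN 2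
    simpa [div_pow] using this
  -- the mesh
  set δ : ℝ := 1 / N with hδ
  have hδ0 : 0 < δ := by positivity
  have hδ4 : δ ≤ 1 / 4 := one_div_le_one_div_of_le (by norm_num) hN4
  set t : ℝ := (i : ℝ) / N with ht
  have hnR : (N : ℝ) = 4 * n := by rw [hNn]; push_cast; ring
  have ht1 : t = 1 / 4 ∨ 1 / 4 + δ ≤ t := by
    rcases (by omega : i = n ∨ n + 1 ≤ i) with h1 | h1
    · left
      rw [ht, h1, div_eq_div_iff hNpos.ne' (by norm_num), hnR]; ring
    · right
      have h2 : (n:ℝ) + 1 ≤ i := by exact_mod_cast h1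
      rw [ht, hδ, le_div_iff₀ hNpos, add_mul, one_div_mul_cancel hNpos.ne', hnR]
      linarith
  have ht2 : t + δ ≤ 1 / 2 := by
    have h2 : (i:ℝ) + 1 ≤ 2 * n := by exact_mod_cast (by omega : i + 1 ≤ 2 * n)
    rw [ht, hδ, ← add_div, div_le_iff₀ hNpos, hnR]
    linarith
  obtain ⟨g0, g01, g12, ghh, gdd, g2⟩ := shishkinPsi_consecutive hlam0 hlam4 hδ0 hδ4 ht1 ht2
  have hi : 1 ≤ i := by omega
  have e0 : x (i - 1) = shishkinPsi lam (t - δ) := by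
    simp only [x, ht, hδ, Nat.cast_sub hi, Nat.cast_one, sub_div]
  have e2 : x (i + 1) = shishkinPsi lam (t + δ) := by
    simp only [x, ht, hδ, Nat.cast_add, Nat.cast_one, add_div]
  have e1 : x i = shishkinPsi lam t := rfl
  rw [← e0] at g0
  rw [← e0, ← e1] at g01
  rw [← e1, ← e2] at g12
  rw [← e0, ← e1, ← e2] at ghh gdd
  rw [← e2] at g2
  have eh : h (i - 1) = x i - x (i - 1) := by
    simp only [h, Nat.sub_add_cancel hi]
  have eh' : h i = x (i + 1) - x i := rfl
  rw [eh, eh']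
  set a : ℝ := lam * (1 - 4 / N) with ha
  have ha0 : 0 ≤ a := mul_nonneg hlam0.le (sub_nonneg.2 ((div_le_one hNpos).2 hN4))
  have ha4 : a ≤ 1 / 4 := by
    have : a ≤ lam * 1 := mul_le_mul_of_nonneg_left (by
      have : 0 ≤ 4 / (N:ℝ) := by positivity
      linarith) hlam0.le
    linarith
  have hax : a ≤ x (i - 1) := by
    refine le_trans ?_ g0
    have h14 : 1 / 4 ≤ t := by rcases ht1 with h1 | h1 <;> linarith
    have : a = 4 * lam * (1 / 4 - δ) := by rw [ha, hδ]; ring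
    rw [this]
    gcongr
  have hsub : Ioo a (1 / 2) ⊆ Ioo 0 1 := Ioo_subset_Ioo ha0 (by norm_num)
  have hsubx : Ioo (x (i - 1)) (x (i + 1)) ⊆ Ioo a (1 / 2) := Ioo_subset_Ioo hax g2
  have hsubI : Icc (x (i - 1)) (x (i + 1)) ⊆ Icc 0 1 :=
    Icc_subset_Icc (ha0.trans hax) (by linarith)
  -- the layer component `y - z`
  set s : ℝ → ℝ := fun t => y t - z t with hs
  set s' : ℝ → ℝ := fun t => derivWithin y (Icc 0 1) t - z' t with hs'
  set s'' : ℝ → ℝ := fun t => iteratedDerivWithin 2 y (Icc 0 1) t - z'' t with hs''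
  have hsc : ContinuousOn s (Icc 0 1) := hy.continuousOn.sub hzc
  have hsd : ∀ t ∈ Ioo (0:ℝ) 1, HasDerivAt s (s' t) t := fun t ht =>
    (hasDerivAt_derivWithin_of_contDiffOn_two hy ht).1.sub (hz1 t ht)
  have hsd' : ∀ t ∈ Ioo (0:ℝ) 1, HasDerivAt s' (s'' t) t := fun t ht =>
    (hasDerivAt_derivWithin_of_contDiffOn_two hy ht).2.sub (hz2 t ht)
  have hfd : ∀ t ∈ Icc (0:ℝ) 1, Differentiable ℝ (f t) := fun t ht u =>
    differentiableAt_of_deriv_ne_zero (hm.trans_le (hfy t ht u)).ne'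
  have hsode : ∀ t ∈ Ioo (0:ℝ) 1, ε ^ 2 * s'' t = f t (y t) - f t (z t) - ε ^ 2 * z'' t := by
    intro t ht
    rw [hs'', mul_sub, hode t ht, hz0 t (Ioo_subset_Icc_self ht), sub_zero]
  have hz''b : ∀ t ∈ Icc (0:ℝ) 1, |ε ^ 2 * z'' t| ≤ ε ^ 2 * Z := by
    intro t ht
    rw [abs_mul, abs_of_nonneg (sq_nonneg ε)]
    exact mul_le_mul_of_nonneg_left (hzb t ht).2.2 (sq_nonneg ε)
  have hbar := abs_le_boundary_layer_barrier hε hm hZ hsc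
    (by simpa [hs, hy0] using (hzb 0 ⟨le_rfl, zero_le_one⟩).1)
    (by simpa [hs, hy1] using (hzb 1 ⟨zero_le_one, le_rfl⟩).1) hsd hsd'
    (fun t ht hpos => by
      have htI := Ioo_subset_Icc_self ht
      have h1 := mul_sub_le_image_sub_of_le_deriv (hfd t htI) (hfy t htI)
        (sub_pos.1 hpos).le
      have h2 := (abs_le.1 (hz''b t htI)).2
      rw [hsode t ht]
      linarith)
    (fun t ht hneg => by
      have htI := Ioo_subset_Icc_self ht
      have h1 := mul_sub_le_image_sub_of_le_deriv (hfd t htI) (hfy t htI)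
        (sub_neg.1 hneg).le
      have h2 := (abs_le.1 (hz''b t htI)).1
      rw [hsode t ht]
      simp only [hs]
      linarith)
  have hsM : ∀ t ∈ Ioo a (1 / 2), |s t| ≤ M / (N:ℝ) ^ 2 := by
    intro t ht
    refine (hbar t (Ioo_subset_Icc_self (hsub ht))).trans ?_
    have b1 : Real.exp (-(√m / ε) * t) ≤ Real.exp 8 / (N:ℝ) ^ 2 :=
      exp_neg_le_of_transition_le hm hε (by linarith) ht.1.le
    have b2 : Real.exp (-(√m / ε) * (1 - t)) ≤ Real.exp 8 / (N:ℝ) ^ 2 :=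
      exp_neg_le_of_transition_le hm hε (by linarith) (by
        have := ht.1
        have := ht.2
        linarith)
    have b3 : ε ^ 2 * Z / m ≤ 1 / (N:ℝ) ^ 2 * Z / m := by gcongr
    have b4 := mul_le_mul_of_nonneg_left (add_le_add b1 b2) hZ
    refine (add_le_add b4 b3).trans_eq ?_
    rw [hM]; field_simp; ring
  have hlayer := scaled_deriv_bounds (γ := γ) (R := Z / (N:ℝ) ^ 2) hε hε1
    (by linarith : (1:ℝ) / 4 ≤ 1 / 2 - a) (fun t ht => hsd t (hsub ht))
    (fun t ht => hsd' t (hsub ht)) hγ0.le hsM (fun t ht => by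
      have htI := Ioo_subset_Icc_self (hsub ht)
      have h1 : |f t (y t) - f t (z t)| ≤ γ * |y t - z t| :=
        convex_univ.norm_image_sub_le_of_norm_deriv_le (fun u _ => hfd t htI u)
          (fun u _ => by
            rw [Real.norm_eq_abs, abs_of_pos (hm.trans_le (hfy t htI u))]
            exact hγ t htI u) (mem_univ _) (mem_univ _)
      have h2 := hz''b t htI
      have h3 : ε ^ 2 * Z ≤ Z / (N:ℝ) ^ 2 := by
        refine (mul_le_mul_of_nonneg_right hεN2 hZ).trans_eq (by ring)
      have h4 : ε ^ 2 * |s'' t| = |f t (y t) - f t (z t) - ε ^ 2 * z'' t| := by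
        rw [← hsode t (hsub ht), abs_mul, abs_of_nonneg (sq_nonneg ε)]
      rw [h4]
      have h5 := abs_sub (f t (y t) - f t (z t)) (ε ^ 2 * z'' t)
      simp only [hs]
      linarith)
  have hr := sinh_difference_bound_of_deriv_bounds hβ g01 g12 ghh (hzc.mono hsubI)
    (fun t ht => hz1 t (hsub (hsubx ht))) (fun t ht => hz2 t (hsub (hsubx ht)))
    (fun t ht => (hzb t (Ioo_subset_Icc_self (hsub (hsubx ht)))).2.1)
    (fun t ht => (hzb t (Ioo_subset_Icc_self (hsub (hsubx ht)))).2.2)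
  have hl := sinh_difference_bound_of_deriv_bounds hβ g01 g12 ghh (hsc.mono hsubI)
    (fun t ht => hsd t (hsub (hsubx ht))) (fun t ht => hsd' t (hsub (hsubx ht)))
    (fun t ht => (hlayer t (hsubx ht)).1) (fun t ht => (hlayer t (hsubx ht)).2)
  have hβ2 : β ^ 2 = γ / ε ^ 2 := by rw [div_pow, Real.sq_sqrt hγ0.le]
  have hr' : Z * min ((x (i + 1) - x i) - (x i - x (i - 1))) β⁻¹ + 4 * Z / β ^ 2 ≤
      (48 * Z + 4 * Z / γ) / (N:ℝ) ^ 2 := by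
    have h1 : Z * min ((x (i + 1) - x i) - (x i - x (i - 1))) β⁻¹ ≤ Z * (48 * δ ^ 2) :=
      mul_le_mul_of_nonneg_left ((min_le_left _ _).trans gdd) hZ
    have h2 : 4 * Z / β ^ 2 ≤ 4 * Z / γ * (1 / (N:ℝ) ^ 2) := by
      have : 4 * Z / β ^ 2 = 4 * Z / γ * ε ^ 2 := by rw [hβ2]; field_simp
      rw [this]
      gcongr
    refine (add_le_add h1 h2).trans_eq ?_
    rw [hδ]; field_simp
  have hl' : (32 * (M / (N:ℝ) ^ 2) + (γ * (M / (N:ℝ) ^ 2) + Z / (N:ℝ) ^ 2)) / ε *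
        min ((x (i + 1) - x i) - (x i - x (i - 1))) β⁻¹ +
        4 * ((γ * (M / (N:ℝ) ^ 2) + Z / (N:ℝ) ^ 2) / ε ^ 2) / β ^ 2 ≤
      ((32 * M + (γ * M + Z)) / √γ + 4 * (γ * M + Z) / γ) / (N:ℝ) ^ 2 := by
    refine (add_le_add_left (mul_le_mul_of_nonneg_left (min_le_right _ _)
      (by positivity)) _).trans_eq ?_
    rw [hβ2, show β⁻¹ = ε / √γ from inv_div _ _]
    field_simp
  have hsplit : ((y (x (i - 1)) - y (x i)) / Real.sinh (β * (x i - x (i - 1))) -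
        (y (x i) - y (x (i + 1))) / Real.sinh (β * (x (i + 1) - x i))) /
        (Acoef β (x i - x (i - 1)) + Acoef β (x (i + 1) - x i)) =
      ((z (x (i - 1)) - z (x i)) / Real.sinh (β * (x i - x (i - 1))) -
        (z (x i) - z (x (i + 1))) / Real.sinh (β * (x (i + 1) - x i))) /
        (Acoef β (x i - x (i - 1)) + Acoef β (x (i + 1) - x i)) +
      ((s (x (i - 1)) - s (x i)) / Real.sinh (β * (x i - x (i - 1))) -
        (s (x i) - s (x (i + 1))) / Real.sinh (β * (x (i + 1) - x i))) /
        (Acoef β (x i - x (i - 1)) + Acoef β (x (i + 1) - x i)) := by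
    simp only [hs]; ring
  rw [hsplit]
  refine (abs_add_le _ _).trans ((add_le_add (hr.trans hr') (hl.trans hl')).trans ?_)
  rw [← add_div]
  exact div_le_div_of_nonneg_right (by linarith) (by positivity)
end

section
/- There exists a constant C > 0 independent of ε and N such that, when λ = 2ε ln N/√m < 1/4 (so that h_{i−1} = h_i = 4λ/N in the fine part of the mesh), the consistency error of the scheme at the exact solution satisfies |T(y(x_0),…,y(x_N))_i| ≤ C (ln² N)/N² for all i = 1, …, N/4 − 1, where y is the exact solution of the boundary value problem. -/
/-- `B(h) = (cosh(βh) + 1)/sinh(βh)`. -/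
noncomputable def Bcoef (β h : ℝ) : ℝ := (Real.cosh (β * h) + 1) / Real.sinh (β * h)

/-- The `i`-th component of the discrete operator `T` generated by the difference
scheme: `Tu_0 = -u_0`, `Tu_N = -u_N`, and for interior `i`,
`Tu_i = γ/(A(h_{i-1})+A(h_i)) · [ B(h_{i-1})u_{i-1} − (B(h_{i-1})+B(h_i))u_i + B(h_i)u_{i+1}`
`− (f(x_{i-1},u_{i-1})+f(x_i,u_i))A(h_{i-1})/γ − (f(x_i,u_i)+f(x_{i+1},u_{i+1}))A(h_i)/γ ]`. -/
noncomputable def Tdisc (f : ℝ → ℝ → ℝ) (γ β : ℝ) (x : ℕ → ℝ) (N : ℕ)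
    (u : ℕ → ℝ) (i : ℕ) : ℝ :=
  if i = 0 ∨ i = N then -u i
  else
    let h : ℕ → ℝ := fun k => x (k + 1) - x k
    γ / (Acoef β (h (i - 1)) + Acoef β (h i)) *
      (Bcoef β (h (i - 1)) * u (i - 1) -
        (Bcoef β (h (i - 1)) + Bcoef β (h i)) * u i + Bcoef β (h i) * u (i + 1) -
        (f (x (i - 1)) (u (i - 1)) + f (x i) (u i)) * Acoef β (h (i - 1)) / γ -
        (f (x i) (u i) + f (x (i + 1)) (u (i + 1))) * Acoef β (h i) / γ)

/-- At a point where the first derivative vanishes and the second derivative is positive, a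
function on the real line has no local maximum. -/
theorem not_isLocalMax_of_hasDerivAt_pos {y y₁ : ℝ → ℝ} {a b : ℝ}
    (hy : ∀ᶠ x in nhds a, HasDerivAt y (y₁ x) x) (hy₁ : HasDerivAt y₁ b a) (hb : 0 < b) :
    ¬ IsLocalMax y a := by
  intro hmax
  have hev : deriv y =ᶠ[nhds a] y₁ := hy.mono fun x hx => hx.deriv
  have hdd : deriv (deriv y) a = b := by rw [hev.deriv_eq, hy₁.deriv]
  have hmin : IsLocalMin y a :=
    isLocalMin_of_deriv_deriv_pos (hdd ▸ hb) hmax.deriv_eq_zero hy.self_of_nhds.continuousAt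
  have hconst : y =ᶠ[nhds a] fun _ => y a := by
    filter_upwards [hmax, hmin] with x h₁ h₂ using le_antisymm h₁ h₂
  have h0 : deriv y =ᶠ[nhds a] fun _ => 0 := by
    simpa using hconst.deriv
  have : deriv (deriv y) a = 0 := by rw [h0.deriv_eq]; simp
  linarith

/-- Maximum principle: a function vanishing at the endpoints whose second derivative is positive
wherever the function exceeds `R ≥ 0` is bounded above by `R`. -/
theorem le_of_second_deriv_pos {y y₁ y₂ : ℝ → ℝ} {R : ℝ} (hR : 0 ≤ R)
    (hc : ContinuousOn y (Set.Icc 0 1)) (h0 : y 0 = 0) (h1 : y 1 = 0)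
    (hy : ∀ x ∈ Set.Ioo (0:ℝ) 1, HasDerivAt y (y₁ x) x)
    (hy₁ : ∀ x ∈ Set.Ioo (0:ℝ) 1, HasDerivAt y₁ (y₂ x) x)
    (hpos : ∀ x ∈ Set.Ioo (0:ℝ) 1, R < y x → 0 < y₂ x) :
    ∀ x ∈ Set.Icc (0:ℝ) 1, y x ≤ R := by
  obtain ⟨a, ha, hmax⟩ := isCompact_Icc.exists_isMaxOn ⟨0, by simp⟩ hc
  intro x hx
  refine (hmax hx).trans ?_
  by_contra! hlt
  have ha' : a ∈ Set.Ioo (0:ℝ) 1 := by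
    refine ⟨lt_of_le_of_ne ha.1 ?_, lt_of_le_of_ne ha.2 ?_⟩ <;> rintro rfl <;> linarith
  refine not_isLocalMax_of_hasDerivAt_pos ?_ (hy₁ a ha') (hpos a ha' hlt)
    (hmax.isLocalMax (Icc_mem_nhds ha'.1 ha'.2))
  filter_upwards [Ioo_mem_nhds ha'.1 ha'.2] with z hz using hy z hz

/-- A mean value inequality using derivatives only in the open interval. -/
theorem abs_sub_le_of_hasDerivAt_Ioo {g g' : ℝ → ℝ} {a b M : ℝ} (hab : a ≤ b)
    (hc : ContinuousOn g (Set.Icc a b)) (hg : ∀ x ∈ Set.Ioo a b, HasDerivAt g (g' x) x)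
    (hM : ∀ x ∈ Set.Ioo a b, |g' x| ≤ M) : |g b - g a| ≤ M * (b - a) := by
  rcases hab.eq_or_lt with rfl | hlt
  · simp
  obtain ⟨c, hcm, h⟩ := exists_hasDerivAt_eq_slope g g' hlt hc hg
  have hpos : 0 < b - a := sub_pos.2 hlt
  rw [eq_div_iff hpos.ne'] at h
  rw [← h, abs_mul, abs_of_pos hpos]
  exact mul_le_mul_of_nonneg_right (hM c hcm) hpos.le

/-- Second symmetric differences are controlled by the symmetrised second derivative. -/
theorem abs_symm_diff_sub_le {y y₁ y₂ : ℝ → ℝ} {x h c M : ℝ} (hh : 0 ≤ h) (hM0 : 0 ≤ M)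
    (hl : 0 ≤ x - h) (hr : x + h ≤ 1)
    (hc : ContinuousOn y (Set.Icc 0 1)) (hc₁ : ContinuousOn y₁ (Set.Icc 0 1))
    (hy : ∀ x ∈ Set.Ioo (0:ℝ) 1, HasDerivAt y (y₁ x) x)
    (hy₁ : ∀ x ∈ Set.Ioo (0:ℝ) 1, HasDerivAt y₁ (y₂ x) x)
    (hM : ∀ s ∈ Set.Ioo 0 h, |y₂ (x + s) + y₂ (x - s) - c| ≤ M) :
    |y (x + h) + y (x - h) - 2 * y x - c * h ^ 2 / 2| ≤ M * h ^ 2 := by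
  have hp : ∀ s ∈ Set.Icc 0 h, x + s ∈ Set.Icc (0:ℝ) 1 := fun s hs =>
    ⟨by linarith [hs.1], by linarith [hs.2]⟩
  have hn : ∀ s ∈ Set.Icc 0 h, x - s ∈ Set.Icc (0:ℝ) 1 := fun s hs =>
    ⟨by linarith [hs.2], by linarith [hs.1]⟩
  have hp' : ∀ s ∈ Set.Ioo 0 h, x + s ∈ Set.Ioo (0:ℝ) 1 := fun s hs =>
    ⟨by linarith [hs.1], by linarith [hs.2]⟩
  have hn' : ∀ s ∈ Set.Ioo 0 h, x - s ∈ Set.Ioo (0:ℝ) 1 := fun s hs =>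
    ⟨by linarith [hs.2], by linarith [hs.1]⟩
  have hfirst : ∀ s ∈ Set.Icc 0 h, |y₁ (x + s) - y₁ (x - s) - c * s| ≤ M * h := by
    intro s hs
    have key := abs_sub_le_of_hasDerivAt_Ioo (g := fun s => y₁ (x + s) - y₁ (x - s) - c * s)
      (g' := fun s => y₂ (x + s) + y₂ (x - s) - c) (M := M) hs.1 ?_ ?_ ?_
    · have : M * s ≤ M * h := mul_le_mul_of_nonneg_left hs.2 hM0
      simp at key
      linarith
    · have hsub : Set.Icc 0 s ⊆ Set.Icc 0 h := Set.Icc_subset_Icc_right hs.2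
      refine ((hc₁.comp (by fun_prop) fun t ht => hp t (hsub ht)).sub
        (hc₁.comp (by fun_prop) fun t ht => hn t (hsub ht))).sub (by fun_prop)
    · intro t ht
      have ht' : t ∈ Set.Ioo 0 h := ⟨ht.1, ht.2.trans_le hs.2⟩
      have e₁ := (hy₁ _ (hp' t ht')).comp_const_add x t
      have e₂ := (hy₁ _ (hn' t ht')).comp_const_sub x t
      exact ((e₁.sub e₂).sub ((hasDerivAt_id t).const_mul c)).congr_deriv (by ring)
    · exact fun t ht => hM t ⟨ht.1, ht.2.trans_le hs.2⟩
  have key := abs_sub_le_of_hasDerivAt_Ioo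
    (g := fun s => y (x + s) + y (x - s) - c * s ^ 2 / 2)
    (g' := fun s => y₁ (x + s) - y₁ (x - s) - c * s) (M := M * h) hh ?_ ?_ ?_
  · simp only [add_zero, sub_zero] at key
    refine le_trans (le_of_eq ?_) (key.trans (le_of_eq (by ring)))
    congr 1
    ring
  · exact ((hc.comp (by fun_prop) hp).add (hc.comp (by fun_prop) hn)).sub (by fun_prop)
  · intro t ht
    have e₁ := (hy _ (hp' t ht)).comp_const_add x t
    have e₂ := (hy _ (hn' t ht)).comp_const_sub x t
    refine ((e₁.add e₂).sub ((((hasDerivAt_id t).pow 2).const_mul c).div_const 2)).congr_deriv ?_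
    simp only [id_eq]
    ring
  · exact fun t ht => hfirst t ⟨ht.1.le, ht.2.le⟩

/-- A bounded function whose second derivative is `O(ε⁻²)` has a derivative of size `O(ε⁻¹)`. -/
theorem abs_deriv_le_of_second_deriv {y y₁ y₂ : ℝ → ℝ} {ε R K : ℝ} (hε : 0 < ε) (hε1 : ε < 1)
    (hK : 0 ≤ K)
    (hc : ContinuousOn y (Set.Icc 0 1)) (hc₁ : ContinuousOn y₁ (Set.Icc 0 1))
    (hy : ∀ x ∈ Set.Ioo (0:ℝ) 1, HasDerivAt y (y₁ x) x)
    (hy₁ : ∀ x ∈ Set.Ioo (0:ℝ) 1, HasDerivAt y₁ (y₂ x) x)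
    (hR : ∀ x ∈ Set.Icc (0:ℝ) 1, |y x| ≤ R)
    (hK₂ : ∀ x ∈ Set.Ioo (0:ℝ) 1, |y₂ x| ≤ K / ε ^ 2) :
    ∀ x ∈ Set.Icc (0:ℝ) 1, |y₁ x| ≤ (2 * R + K) / ε := by
  intro x hx
  obtain ⟨a, ha0, hax, hxa, ha1⟩ : ∃ a, 0 ≤ a ∧ a ≤ x ∧ x ≤ a + ε ∧ a + ε ≤ 1 := by
    rcases le_total (x + ε) 1 with h | h
    · exact ⟨x, hx.1, le_rfl, by linarith, h⟩
    · exact ⟨1 - ε, by linarith, by linarith, by linarith [hx.2], by linarith⟩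
  obtain ⟨c, hcm, hslope⟩ := exists_hasDerivAt_eq_slope y y₁ (by linarith : a < a + ε)
    (hc.mono (Set.Icc_subset_Icc ha0 ha1)) fun z hz => hy z ⟨by linarith [hz.1], by linarith [hz.2]⟩
  have hslope_le : |y₁ c| ≤ 2 * R / ε := by
    rw [hslope, add_sub_cancel_left, abs_div, abs_of_pos hε]
    gcongr
    have h₁ := abs_le.1 (hR a ⟨ha0, by linarith⟩)
    have h₂ := abs_le.1 (hR (a + ε) ⟨by linarith, ha1⟩)
    exact abs_le.2 ⟨by linarith, by linarith⟩
  have hlip : ∀ u v, u ∈ Set.Icc a (a + ε) → v ∈ Set.Icc a (a + ε) → u ≤ v →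
      |y₁ v - y₁ u| ≤ K / ε := by
    intro u v hu hv huv
    have key := abs_sub_le_of_hasDerivAt_Ioo huv
      (hc₁.mono (Set.Icc_subset_Icc (by linarith [hu.1]) (by linarith [hv.2])))
      (fun z hz => hy₁ z ⟨by linarith [hu.1, hz.1], by linarith [hv.2, hz.2]⟩)
      (fun z hz => hK₂ z ⟨by linarith [hu.1, hz.1], by linarith [hv.2, hz.2]⟩)
    calc _ ≤ K / ε ^ 2 * (v - u) := key
      _ ≤ K / ε ^ 2 * ε := by
        refine mul_le_mul_of_nonneg_left ?_ (by positivity)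
        linarith [hu.1, hv.2]
      _ = K / ε := by field_simp
  have hdiff : |y₁ x - y₁ c| ≤ K / ε := by
    rcases le_total c x with h | h
    · exact hlip c x ⟨hcm.1.le, hcm.2.le⟩ ⟨hax, hxa⟩ h
    · rw [abs_sub_comm]
      exact hlip x c ⟨hax, hxa⟩ ⟨hcm.1.le, hcm.2.le⟩ h
  have := abs_sub_abs_le_abs_sub (y₁ x) (y₁ c)
  rw [add_div]
  linarith

theorem sinh_le_mul_cosh {z : ℝ} (hz : 0 < z) : Real.sinh z ≤ z * Real.cosh z := by
  obtain ⟨c, hc, h⟩ := exists_hasDerivAt_eq_slope Real.sinh Real.cosh hz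
    Real.continuous_sinh.continuousOn fun x _ => Real.hasDerivAt_sinh x
  rw [Real.sinh_zero, sub_zero, sub_zero, eq_div_iff hz.ne'] at h
  rw [← h, mul_comm]
  refine mul_le_mul_of_nonneg_left (Real.cosh_le_cosh.2 ?_) hz.le
  rw [abs_of_pos hc.1, abs_of_pos hz]
  exact hc.2.le

/-- The exponential fitting factor `B/A = coth²(t/2)` differs from `4/t²` by at most one. -/
theorem abs_cosh_ratio_sub_le {t : ℝ} (ht : 0 < t) :
    |(Real.cosh t + 1) / (Real.cosh t - 1) - 4 / t ^ 2| ≤ 1 := by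
  obtain ⟨z, rfl⟩ : ∃ z, t = 2 * z := ⟨t / 2, by ring⟩
  have hz : 0 < z := by linarith
  have hS : z ≤ Real.sinh z := Real.self_le_sinh_iff.2 hz.le
  have hSpos : 0 < Real.sinh z := hz.trans_le hS
  have hcs := Real.cosh_sq z
  have hq : (Real.cosh (2 * z) + 1) / (Real.cosh (2 * z) - 1) - 4 / (2 * z) ^ 2
      = Real.cosh z ^ 2 / Real.sinh z ^ 2 - 1 / z ^ 2 := by
    rw [Real.cosh_two_mul, hcs]
    have h1 : Real.sinh z ^ 2 + 1 + Real.sinh z ^ 2 - 1 = 2 * Real.sinh z ^ 2 := by ring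
    rw [h1]
    field_simp
    ring
  rw [hq, abs_le]
  constructor
  · have : 1 / z ^ 2 ≤ Real.cosh z ^ 2 / Real.sinh z ^ 2 := by
      rw [div_le_div_iff₀ (by positivity) (by positivity), one_mul, ← mul_pow,
        mul_comm (Real.cosh z)]
      exact pow_le_pow_left₀ hSpos.le (sinh_le_mul_cosh hz) 2
    linarith
  · have h₁ : 1 / Real.sinh z ^ 2 ≤ 1 / z ^ 2 := by gcongr
    rw [hcs, add_div, div_self (by positivity)]
    linarith

/-- Second-order Taylor bound, uniform over a compact convex rectangle, for a `C²` function on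
the strip `[0,1] × ℝ`. -/
theorem exists_taylor_bound {g : ℝ × ℝ → ℝ}
    (hg : ContDiffOn ℝ 2 g (Set.Icc 0 1 ×ˢ Set.univ)) (R : ℝ) :
    ∃ (D : ℝ × ℝ → ℝ × ℝ →L[ℝ] ℝ) (K L M : ℝ), 0 ≤ K ∧ 0 ≤ L ∧ 0 ≤ M ∧
      (∀ p ∈ Set.Icc (0:ℝ) 1 ×ˢ Set.Icc (-R) R, |g p| ≤ K) ∧
      (∀ p ∈ Set.Icc (0:ℝ) 1 ×ˢ Set.Icc (-R) R, ‖D p‖ ≤ L) ∧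
      ∀ p ∈ Set.Icc (0:ℝ) 1 ×ˢ Set.Icc (-R) R, ∀ q ∈ Set.Icc (0:ℝ) 1 ×ˢ Set.Icc (-R) R,
        |g q - g p - D p (q - p)| ≤ M * ‖q - p‖ ^ 2 := by
  set S : Set (ℝ × ℝ) := Set.Icc 0 1 ×ˢ Set.univ
  set Q : Set (ℝ × ℝ) := Set.Icc (0:ℝ) 1 ×ˢ Set.Icc (-R) R
  have hQS : Q ⊆ S := Set.prod_mono_right (Set.subset_univ _)
  have hQc : IsCompact Q := isCompact_Icc.prod isCompact_Icc
  have hQconv : Convex ℝ Q := (convex_Icc _ _).prod (convex_Icc _ _)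
  have hS : UniqueDiffOn ℝ S := (uniqueDiffOn_Icc zero_lt_one).prod uniqueDiffOn_univ
  have hD : ContDiffOn ℝ 1 (fderivWithin ℝ g S) S := hg.fderivWithin hS (by norm_num)
  obtain ⟨K, hK⟩ := hQc.exists_bound_of_continuousOn (hg.continuousOn.mono hQS)
  obtain ⟨L, hL⟩ := hQc.exists_bound_of_continuousOn (hD.continuousOn.mono hQS)
  obtain ⟨M, hM⟩ := (hD.mono hQS).exists_lipschitzOnWith one_ne_zero hQconv hQc
  refine ⟨fderivWithin ℝ g S, max K 0, max L 0, M, le_max_right _ _, le_max_right _ _, M.2,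
    fun p hp => (hK p hp).trans (le_max_left _ _), fun p hp => (hL p hp).trans (le_max_left _ _),
    fun p hp q hq => ?_⟩
  have hseg : segment ℝ p q ⊆ Q := hQconv.segment_subset hp hq
  have key := (convex_segment p q).norm_image_sub_le_of_norm_hasFDerivWithin_le'
    (f := g) (f' := fderivWithin ℝ g S) (φ := fderivWithin ℝ g S p) (C := M * ‖q - p‖)
    (fun z hz => ((hg.differentiableOn (by norm_num) z (hQS (hseg hz))).hasFDerivWithinAt).mono
      (hseg.trans hQS))
    (fun z hz => ?_) (left_mem_segment ℝ p q) (right_mem_segment ℝ p q)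
  · rw [Real.norm_eq_abs] at key
    refine key.trans (le_of_eq (by ring))
  · refine (hM.norm_sub_le (hseg hz) hp).trans ?_
    refine mul_le_mul_of_nonneg_left ?_ M.2
    obtain ⟨θ, hθ, rfl⟩ := (segment_eq_image' ℝ p q) ▸ hz
    rw [add_sub_cancel_left, norm_smul, Real.norm_eq_abs, abs_of_nonneg hθ.1]
    exact mul_le_of_le_one_left (norm_nonneg _) hθ.2

/-- Second symmetric differences of `x ↦ g (x, y x)` on the scale `ε`. -/
theorem abs_symm_diff_comp_le {g : ℝ × ℝ → ℝ} {D : ℝ × ℝ → ℝ × ℝ →L[ℝ] ℝ} {y : ℝ → ℝ}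
    {x s ε R L M P Q : ℝ} (hε : 0 < ε) (hε1 : ε < 1) (hP : 0 ≤ P) (hM0 : 0 ≤ M) (hL0 : 0 ≤ L)
    (hD : ∀ p ∈ Set.Icc (0:ℝ) 1 ×ˢ Set.Icc (-R) R, ‖D p‖ ≤ L)
    (hT : ∀ p ∈ Set.Icc (0:ℝ) 1 ×ˢ Set.Icc (-R) R, ∀ q ∈ Set.Icc (0:ℝ) 1 ×ˢ Set.Icc (-R) R,
      |g q - g p - D p (q - p)| ≤ M * ‖q - p‖ ^ 2)
    (hs : 0 ≤ s) (hl : 0 ≤ x - s) (hr : x + s ≤ 1)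
    (hR : ∀ x ∈ Set.Icc (0:ℝ) 1, |y x| ≤ R)
    (hlip : ∀ u ∈ Set.Icc (0:ℝ) 1, ∀ v ∈ Set.Icc (0:ℝ) 1, u ≤ v →
      |y v - y u| ≤ P / ε * (v - u))
    (hQ : |y (x + s) + y (x - s) - 2 * y x| ≤ Q * (s / ε) ^ 2) :
    |g (x + s, y (x + s)) + g (x - s, y (x - s)) - 2 * g (x, y x)| ≤
      (2 * M * (1 + P) ^ 2 + L * Q) * (s / ε) ^ 2 := by
  have hx : x ∈ Set.Icc (0:ℝ) 1 := ⟨by linarith, by linarith⟩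
  have hxp : x + s ∈ Set.Icc (0:ℝ) 1 := ⟨by linarith, by linarith⟩
  have hxn : x - s ∈ Set.Icc (0:ℝ) 1 := ⟨by linarith, by linarith⟩
  have mem : ∀ z ∈ Set.Icc (0:ℝ) 1, (z, y z) ∈ Set.Icc (0:ℝ) 1 ×ˢ Set.Icc (-R) R :=
    fun z hz => ⟨hz, abs_le.1 (hR z hz)⟩
  have hsε : s ≤ (1 + P) * (s / ε) := by
    have h₁ : s ≤ s / ε := (le_div_iff₀ hε).2 (mul_le_of_le_one_right hs hε1.le)
    have h₂ : 0 ≤ P * (s / ε) := by positivity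
    linarith
  have hPs : P / ε * s ≤ (1 + P) * (s / ε) := by
    have h₁ : P / ε * s = P * (s / ε) := by ring
    have h₂ : 0 ≤ s / ε := by positivity
    linarith
  have hpos : ‖(x + s, y (x + s)) - (x, y x)‖ ≤ (1 + P) * (s / ε) := by
    rw [Prod.mk_sub_mk, Prod.norm_mk, Real.norm_eq_abs, Real.norm_eq_abs, add_sub_cancel_left,
      abs_of_nonneg hs]
    refine max_le hsε (le_trans ?_ hPs)
    simpa using hlip x hx (x + s) hxp (by linarith)
  have hneg : ‖(x - s, y (x - s)) - (x, y x)‖ ≤ (1 + P) * (s / ε) := by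
    rw [Prod.mk_sub_mk, Prod.norm_mk, Real.norm_eq_abs, Real.norm_eq_abs, sub_sub_cancel_left,
      abs_neg, abs_of_nonneg hs]
    refine max_le hsε (le_trans ?_ hPs)
    rw [abs_sub_comm]
    simpa using hlip (x - s) hxn x hx (by linarith)
  have t₁ := (hT _ (mem x hx) _ (mem _ hxp)).trans
    (mul_le_mul_of_nonneg_left (pow_le_pow_left₀ (norm_nonneg _) hpos 2) hM0)
  have t₂ := (hT _ (mem x hx) _ (mem _ hxn)).trans
    (mul_le_mul_of_nonneg_left (pow_le_pow_left₀ (norm_nonneg _) hneg 2) hM0)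
  have hlin : D (x, y x) ((x + s, y (x + s)) - (x, y x)) +
      D (x, y x) ((x - s, y (x - s)) - (x, y x)) =
      D (x, y x) (0, y (x + s) + y (x - s) - 2 * y x) := by
    rw [← map_add]
    congr 1
    ext <;> simp; ring
  have t₃ : |D (x, y x) (0, y (x + s) + y (x - s) - 2 * y x)| ≤ L * (Q * (s / ε) ^ 2) := by
    rw [← Real.norm_eq_abs]
    refine ((D (x, y x)).le_opNorm _).trans ?_
    have hn : ‖((0:ℝ), y (x + s) + y (x - s) - 2 * y x)‖ ≤ Q * (s / ε) ^ 2 := by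
      rw [Prod.norm_mk, norm_zero, Real.norm_eq_abs, max_eq_right (abs_nonneg _)]
      exact hQ
    exact mul_le_mul (hD _ (mem x hx)) hn (norm_nonneg _) hL0
  rw [abs_le] at t₁ t₂ t₃ ⊢
  constructor <;> nlinarith

/-- The interior scheme on two steps of equal length, split into the fitting error, the
truncation error of the central difference, and the averaging error of the right-hand side. -/
theorem scheme_equal_steps {γ ε h u₁ u₂ u₃ f₁ f₂ f₃ : ℝ} (hγ : 0 < γ) (hε : 0 < ε) (hh : 0 < h) :
    γ / (Acoef (√γ / ε) h + Acoef (√γ / ε) h) *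
      (Bcoef (√γ / ε) h * u₁ - (Bcoef (√γ / ε) h + Bcoef (√γ / ε) h) * u₂ + Bcoef (√γ / ε) h * u₃ -
        (f₁ + f₂) * Acoef (√γ / ε) h / γ - (f₂ + f₃) * Acoef (√γ / ε) h / γ) =
    γ / 2 * ((Real.cosh (√γ / ε * h) + 1) / (Real.cosh (√γ / ε * h) - 1)
        - 4 / (√γ / ε * h) ^ 2) * (u₃ + u₁ - 2 * u₂) +
      2 * ε ^ 2 / h ^ 2 * (u₃ + u₁ - 2 * u₂ - 2 * f₂ / ε ^ 2 * h ^ 2 / 2) -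
      (f₃ + f₁ - 2 * f₂) / 2 := by
  have ht : 0 < √γ / ε * h := by positivity
  have hsq : (√γ / ε * h) ^ 2 = γ * h ^ 2 / ε ^ 2 := by
    rw [mul_pow, div_pow, Real.sq_sqrt hγ.le]
    ring
  rw [hsq]
  unfold Acoef Bcoef
  have hc : 0 < Real.cosh (√γ / ε * h) - 1 := sub_pos.2 (Real.one_lt_cosh.2 ht.ne')
  have hS : 0 < Real.sinh (√γ / ε * h) := Real.sinh_pos_iff.2 ht
  generalize Real.cosh (√γ / ε * h) - 1 = c at *
  generalize Real.cosh (√γ / ε * h) + 1 = d at *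
  generalize Real.sinh (√γ / ε * h) = S at *
  field_simp
  ring

/-- The consistency error of the scheme on two equal steps of length `h` is `O(h²/ε²)`, with a
constant depending only on the right-hand side. -/
theorem exists_consistency_bound {m γ : ℝ} {f : ℝ → ℝ → ℝ} (hm : 0 < m) (hγ0 : 0 < γ)
    (hf : ContDiffOn ℝ 2 (Function.uncurry f) (Set.Icc 0 1 ×ˢ Set.univ))
    (hfy : ∀ a ∈ Set.Icc (0:ℝ) 1, ∀ u : ℝ, m ≤ deriv (f a) u) :
    ∃ C > (0:ℝ), ∀ (ε : ℝ) (y : ℝ → ℝ), 0 < ε → ε < 1 →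
      ContDiffOn ℝ 2 y (Set.Icc 0 1) → y 0 = 0 → y 1 = 0 →
      (∀ a ∈ Set.Ioo (0:ℝ) 1,
        ε ^ 2 * iteratedDerivWithin 2 y (Set.Icc 0 1) a = f a (y a)) →
      ∀ x h : ℝ, 0 < h → 0 ≤ x - h → x + h ≤ 1 →
        |γ / (Acoef (√γ / ε) h + Acoef (√γ / ε) h) *
          (Bcoef (√γ / ε) h * y (x - h) - (Bcoef (√γ / ε) h + Bcoef (√γ / ε) h) * y x +
            Bcoef (√γ / ε) h * y (x + h) -
            (f (x - h) (y (x - h)) + f x (y x)) * Acoef (√γ / ε) h / γ -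
            (f x (y x) + f (x + h) (y (x + h))) * Acoef (√γ / ε) h / γ)| ≤
          C * (h / ε) ^ 2 := by
  have hslice : ∀ a ∈ Set.Icc (0:ℝ) 1, Differentiable ℝ (f a) := by
    intro a ha
    have : ContDiffOn ℝ 2 (fun u => Function.uncurry f (a, u)) Set.univ :=
      hf.comp (by fun_prop) fun u _ => ⟨ha, Set.mem_univ _⟩
    exact (contDiffOn_univ.1 this).differentiable (by norm_num)
  obtain ⟨-, K₀, -, -, hK₀, -, -, hK₀f, -, -⟩ := exists_taylor_bound hf 0
  have hf0 : ∀ a ∈ Set.Icc (0:ℝ) 1, |f a 0| ≤ K₀ := fun a ha => hK₀f (a, 0) ⟨ha, by simp⟩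
  set R := K₀ / m with hRdef
  have hR0 : 0 ≤ R := by positivity
  have hmR : m * R = K₀ := by rw [hRdef]; field_simp
  obtain ⟨D, K, L, M, hK, hL, hM, hKf, hLf, hT⟩ := exists_taylor_bound hf R
  set P := 2 * R + K
  have hP : 0 ≤ P := by positivity
  set E := 2 * M * (1 + P) ^ 2 + L * (2 * K)
  have hE : 0 ≤ E := by positivity
  refine ⟨γ * K + 5 / 2 * E + 1, by positivity, ?_⟩
  intro ε y hε hε1 hy2 hy0 hy1 hode x h hh hl hr
  have hc := hy2.continuousOn
  have hUD : UniqueDiffOn ℝ (Set.Icc (0:ℝ) 1) := uniqueDiffOn_Icc zero_lt_one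
  have hdw : ContDiffOn ℝ 1 (derivWithin y (Set.Icc 0 1)) (Set.Icc 0 1) :=
    hy2.derivWithin hUD (by norm_num)
  set y₁ := derivWithin y (Set.Icc 0 1)
  set y₂ := derivWithin y₁ (Set.Icc 0 1)
  have hc₁ := hdw.continuousOn
  have hd : ∀ z ∈ Set.Ioo (0:ℝ) 1, HasDerivAt y (y₁ z) z := fun z hz =>
    ((hy2.differentiableOn (by norm_num)) z (Set.Ioo_subset_Icc_self hz)).hasDerivWithinAt.hasDerivAt
      (Icc_mem_nhds hz.1 hz.2)
  have hd₁ : ∀ z ∈ Set.Ioo (0:ℝ) 1, HasDerivAt y₁ (y₂ z) z := fun z hz =>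
    ((hdw.differentiableOn (by norm_num)) z (Set.Ioo_subset_Icc_self hz)).hasDerivWithinAt.hasDerivAt
      (Icc_mem_nhds hz.1 hz.2)
  have hy₂ : ∀ z ∈ Set.Ioo (0:ℝ) 1, y₂ z = f z (y z) / ε ^ 2 := by
    intro z hz
    have hode' := hode z hz
    rw [iteratedDerivWithin_succ, iteratedDerivWithin_one] at hode'
    rw [eq_div_iff (by positivity), ← hode', mul_comm]
  have hRy : ∀ z ∈ Set.Icc (0:ℝ) 1, |y z| ≤ R := by
    intro z hz
    rw [abs_le']
    refine ⟨le_of_second_deriv_pos hR0 hc hy0 hy1 hd hd₁ ?_ z hz,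
      le_of_second_deriv_pos (y := fun z => -y z) (y₁ := fun z => -y₁ z) (y₂ := fun z => -y₂ z)
        hR0 hc.neg (by simp [hy0]) (by simp [hy1]) (fun z hz => (hd z hz).neg)
        (fun z hz => (hd₁ z hz).neg) ?_ z hz⟩
    · intro w hw hlt
      have hw' := Set.Ioo_subset_Icc_self hw
      rw [hy₂ w hw]
      have h₁ := mul_sub_le_image_sub_of_le_deriv (hslice w hw') (hfy w hw')
        (hR0.trans hlt.le)
      have h₂ := (abs_le.1 (hf0 w hw')).1
      have h₃ := mul_lt_mul_of_pos_left hlt hm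
      exact div_pos (by linarith) (by positivity)
    · intro w hw hlt
      have hw' := Set.Ioo_subset_Icc_self hw
      rw [hy₂ w hw, ← neg_div]
      have h₁ := mul_sub_le_image_sub_of_le_deriv (hslice w hw') (hfy w hw')
        (show y w ≤ 0 by linarith)
      have h₂ := (abs_le.1 (hf0 w hw')).2
      have h₃ := mul_lt_mul_of_pos_left hlt hm
      exact div_pos (by linarith) (by positivity)
  have hFK : ∀ z ∈ Set.Icc (0:ℝ) 1, |f z (y z)| ≤ K := fun z hz =>
    hKf (z, y z) ⟨hz, abs_le.1 (hRy z hz)⟩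
  have hy₂K : ∀ z ∈ Set.Ioo (0:ℝ) 1, |y₂ z| ≤ K / ε ^ 2 := by
    intro z hz
    rw [hy₂ z hz, abs_div, abs_of_pos (by positivity : 0 < ε ^ 2)]
    gcongr
    exact hFK z (Set.Ioo_subset_Icc_self hz)
  have hy₁P := abs_deriv_le_of_second_deriv hε hε1 hK hc hc₁ hd hd₁ hRy hy₂K
  have hlip : ∀ u ∈ Set.Icc (0:ℝ) 1, ∀ v ∈ Set.Icc (0:ℝ) 1, u ≤ v →
      |y v - y u| ≤ P / ε * (v - u) := fun u hu v hv huv =>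
    abs_sub_le_of_hasDerivAt_Ioo huv (hc.mono (Set.Icc_subset_Icc hu.1 hv.2))
      (fun z hz => hd z ⟨hu.1.trans_lt hz.1, hz.2.trans_le hv.2⟩)
      (fun z hz => hy₁P z ⟨hu.1.trans hz.1.le, hz.2.le.trans hv.2⟩)
  have hyd : ∀ s, 0 ≤ s → s ≤ h → |y (x + s) + y (x - s) - 2 * y x| ≤ 2 * K * (s / ε) ^ 2 := by
    intro s hs hsh
    have key := abs_symm_diff_sub_le (c := 0) (M := 2 * (K / ε ^ 2)) hs (by positivity)
      (by linarith : 0 ≤ x - s) (by linarith) hc hc₁ hd hd₁ fun r hrs => by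
        have h₁ := hy₂K (x + r) ⟨by linarith [hrs.1], by linarith [hrs.2]⟩
        have h₂ := hy₂K (x - r) ⟨by linarith [hrs.2], by linarith [hrs.1]⟩
        rw [sub_zero, two_mul]
        exact (abs_add_le _ _).trans (add_le_add h₁ h₂)
    rw [zero_mul, zero_div, sub_zero] at key
    refine key.trans (le_of_eq ?_)
    field_simp
  have hFd : ∀ s, 0 ≤ s → s ≤ h →
      |f (x + s) (y (x + s)) + f (x - s) (y (x - s)) - 2 * f x (y x)| ≤ E * (h / ε) ^ 2 := by
    intro s hs hsh
    refine (abs_symm_diff_comp_le (g := Function.uncurry f) hε hε1 hP hM hL hLf hT hs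
      (by linarith) (by linarith) hRy hlip (hyd s hs hsh)).trans ?_
    gcongr
  have htr := abs_symm_diff_sub_le (c := 2 * f x (y x) / ε ^ 2) (M := E * (h / ε) ^ 2 / ε ^ 2) hh.le
      (by positivity) hl hr hc hc₁ hd hd₁ fun s hs => by
        rw [hy₂ (x + s) ⟨by linarith [hs.1], by linarith [hs.2]⟩,
          hy₂ (x - s) ⟨by linarith [hs.2], by linarith [hs.1]⟩, ← add_div, ← sub_div, abs_div,
          abs_of_pos (by positivity : 0 < ε ^ 2)]
        have := hFd s hs.1.le hs.2.le
        gcongr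
  rw [scheme_equal_steps hγ0 hε hh]
  have e₁ : |γ / 2 * ((Real.cosh (√γ / ε * h) + 1) / (Real.cosh (√γ / ε * h) - 1)
        - 4 / (√γ / ε * h) ^ 2) * (y (x + h) + y (x - h) - 2 * y x)| ≤
      γ * K * (h / ε) ^ 2 := by
    rw [abs_mul, abs_mul, abs_of_pos (by positivity : 0 < γ / 2)]
    calc _ ≤ γ / 2 * 1 * (2 * K * (h / ε) ^ 2) := by
          gcongr
          · exact abs_cosh_ratio_sub_le (by positivity)
          · exact hyd h hh.le le_rfl
      _ = _ := by ring
  have e₂ : |2 * ε ^ 2 / h ^ 2 * (y (x + h) + y (x - h) - 2 * y x -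
      2 * f x (y x) / ε ^ 2 * h ^ 2 / 2)| ≤ 2 * E * (h / ε) ^ 2 := by
    rw [abs_mul, abs_of_pos (by positivity : 0 < 2 * ε ^ 2 / h ^ 2)]
    calc _ ≤ 2 * ε ^ 2 / h ^ 2 * (E * (h / ε) ^ 2 / ε ^ 2 * h ^ 2) := by gcongr
      _ = _ := by field_simp
  have e₃ := hFd h hh.le le_rfl
  have hsq : 0 ≤ (h / ε) ^ 2 := by positivity
  rw [abs_le] at e₁ e₂ e₃ ⊢
  constructor <;> nlinarith

/-- In the fine part the modified Shishkin mesh is uniform. -/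
theorem shishkinPsi_of_le {lam t : ℝ} (ht : t ≤ 1 / 4) : shishkinPsi lam t = 4 * lam * t := by
  rw [shishkinPsi, if_pos (by linarith), if_pos ht]

/-- Consistency error in the fine part of the modified Shishkin mesh: when
`λ = 2ε ln N/√m < 1/4`, the scheme applied to the exact solution satisfies
`|T(y(x_0),…,y(x_N))_i| ≤ C (ln² N)/N²` for `i = 1,…,N/4−1`. -/
theorem consistency_fine_part
    (m γ : ℝ) (k : ℕ) (f : ℝ → ℝ → ℝ)
    (hm : 0 < m) (hk : 2 ≤ k)
    (hf : ContDiffOn ℝ k (Function.uncurry f) (Set.Icc 0 1 ×ˢ Set.univ))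
    (hfy : ∀ a ∈ Set.Icc (0:ℝ) 1, ∀ u : ℝ, m ≤ deriv (f a) u)
    (hγ : ∀ a ∈ Set.Icc (0:ℝ) 1, ∀ u : ℝ, deriv (f a) u ≤ γ) :
    ∃ C > (0:ℝ), ∀ (ε : ℝ) (N : ℕ) (y : ℝ → ℝ),
      0 < ε → ε < 1 → 0 < N → 4 ∣ N →
      ContDiffOn ℝ 2 y (Set.Icc 0 1) → y 0 = 0 → y 1 = 0 →
      (∀ a ∈ Set.Ioo (0:ℝ) 1,
        ε ^ 2 * iteratedDerivWithin 2 y (Set.Icc 0 1) a = f a (y a)) →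
      2 * ε * Real.log N / Real.sqrt m < 1 / 4 →
      let lam : ℝ := 2 * ε * Real.log N / Real.sqrt m
      let β : ℝ := Real.sqrt γ / ε
      let x : ℕ → ℝ := fun i => shishkinPsi lam ((i : ℝ) / (N : ℝ))
      ∀ i : ℕ, 1 ≤ i → i ≤ N / 4 - 1 →
        |Tdisc f γ β x N (fun j => y (x j)) i| ≤
          C * (Real.log N) ^ 2 / (N : ℝ) ^ 2 := by
  have hγm : m ≤ γ := (hfy 0 (by simp) 0).trans (hγ 0 (by simp) 0)
  have hγ0 : 0 < γ := hm.trans_le hγm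
  obtain ⟨C, hC, hmain⟩ := exists_consistency_bound hm hγ0
    (hf.of_le (by exact_mod_cast hk)) hfy
  refine ⟨64 * C / m, by positivity, ?_⟩
  intro ε N y hε hε1 hN hdvd hy2 hy0 hy1 hode hlam lam β x i hi1 hi2
  have h4 : 4 * (i + 1) ≤ N := by omega
  have hNpos : (0:ℝ) < N := by exact_mod_cast hN
  have hlog : 0 < Real.log N := Real.log_pos (by exact_mod_cast (by omega : 1 < N))
  have hlampos : 0 < lam := by simp only [lam]; positivity
  set h : ℝ := 4 * lam / N with hh
  have hhpos : 0 < h := by positivity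
  have hx : ∀ j ≤ i + 1, x j = j * h := by
    intro j hj
    have hle : (j:ℝ) / N ≤ 1 / 4 := by
      rw [div_le_div_iff₀ hNpos (by norm_num)]
      exact_mod_cast (by omega : j * 4 ≤ 1 * N)
    simp only [x]
    rw [shishkinPsi_of_le hle, hh]
    ring
  obtain ⟨j, rfl⟩ : ∃ j, i = j + 1 := ⟨i - 1, by omega⟩
  have hx₁ : x j = x (j + 1) - h := by
    rw [hx j (by omega), hx (j + 1) (by omega)]; push_cast; ring
  have hx₃ : x (j + 1 + 1) = x (j + 1) + h := by
    rw [hx (j + 1) (by omega), hx (j + 1 + 1) (by omega)]; push_cast; ring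
  have hl : 0 ≤ x (j + 1) - h := by rw [← hx₁, hx j (by omega)]; positivity
  have hr : x (j + 1) + h ≤ 1 := by
    rw [← hx₃, hx _ le_rfl, hh]
    have hcast : (4:ℝ) * ((j + 1 + 1 : ℕ) : ℝ) ≤ N := by exact_mod_cast h4
    have hlam' : lam < 1 / 4 := hlam
    rw [mul_div_assoc', div_le_one hNpos]
    nlinarith
  have key := hmain ε y hε hε1 hy2 hy0 hy1 hode (x (j + 1)) h hhpos hl hr
  rw [Tdisc, if_neg (by omega)]
  simp only [Nat.add_sub_cancel, hx₃, hx₁, sub_sub_cancel, add_sub_cancel_left]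
  refine key.trans (le_of_eq ?_)
  have hsm : √m ^ 2 = m := Real.sq_sqrt hm.le
  have hsm0 : 0 < √m := Real.sqrt_pos.2 hm
  have hhε : h / ε = 8 * Real.log N / (√m * N) := by
    simp only [hh, lam]
    field_simp
    ring
  rw [hhε, div_pow, mul_pow, mul_pow, hsm]
  ring
end
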